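/- arXiv:2601.12737 — 3 statements merged into one kernel-verified Lean document; each statement's English description precedes it below -/
import Mathlib

section
/- Let (ν_n)_{n≥1} be a non-decreasing sequence of positive integers and set α = liminf_{n→∞} ν_n/n. If α < ∞, then the Hausdorff dimension of F((ν_n)) is at most 1/(2(1+α)). -/
open Filter MeasureTheory Set
open scoped ENNReal NNReal Topology

/-- The Gauss map `T(x) = 1/x - ⌊1/x⌋`. -/
noncomputable def gaussMap (x : ℝ) : ℝ := 1 / x - ⌊1 / x⌋

/-- The `n`-th partial quotient `a_n(x) = ⌊1 / T^{n-1} x⌋` of the regular continued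
fraction expansion of `x` (meaningful for `n ≥ 1` and `x` irrational in `(0,1)`). -/
noncomputable def pq (x : ℝ) (n : ℕ) : ℕ := (⌊1 / (gaussMap^[n - 1] x)⌋).toNat

/-- The set `J` of irrationals in `(0,1)` with strictly increasing partial quotients. -/
def Jset : Set ℝ :=
  {x | x ∈ Set.Ioo (0 : ℝ) 1 ∧ Irrational x ∧ ∀ n : ℕ, 1 ≤ n → pq x n < pq x (n + 1)}

/-- The finite sequence `b start, b (start+1), …, b (start+len-1)` is an
arithmetic progression. -/
def IsAPAt (b : ℕ → ℕ) (start len : ℕ) : Prop :=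
  ∃ d : ℤ, ∀ i : ℕ, i + 2 ≤ len → (b (start + i + 1) : ℤ) - (b (start + i) : ℤ) = d

/-- The `F`-set: points of `J` such that for infinitely many `n ≥ 1` the partial
quotients `a_n(x), …, a_{n+ν_n-1}(x)` form an arithmetic progression. -/
def Fset (ν : ℕ → ℕ) : Set ℝ :=
  {x | x ∈ Jset ∧ ∀ N : ℕ, ∃ n : ℕ, N ≤ n ∧ 1 ≤ n ∧ IsAPAt (pq x) n (ν n)}

/-- The `G`-set: points of `J` such that for all sufficiently large `n` the partial
quotients `a_{σ_n}(x), …, a_{σ_n+n-1}(x)` form an arithmetic progression. -/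
def Gset (σ : ℕ → ℕ) : Set ℝ :=
  {x | x ∈ Jset ∧ ∃ N : ℕ, ∀ n : ℕ, N ≤ n → IsAPAt (pq x) (σ n) n}

/-! ### The Gauss map and partial quotients -/

theorem Irrational.gaussMap {x : ℝ} (hx : Irrational x) : Irrational (gaussMap x) := by
  have h : Irrational (1 / x) := by simpa using hx.inv
  exact h.sub_intCast _

theorem gaussMap_mem_Ioo {x : ℝ} (hx : Irrational x) : gaussMap x ∈ Ioo (0 : ℝ) 1 := by
  refine ⟨lt_of_le_of_ne ?_ fun h => hx.gaussMap.ne_zero h.symm, Int.fract_lt_one _⟩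
  exact Int.fract_nonneg _

theorem pq_gaussMap (x : ℝ) (n : ℕ) : pq (gaussMap x) (n + 1) = pq x (n + 2) := by
  simp [pq]

theorem one_div_eq_pq_add_gaussMap {x : ℝ} (hx : x ∈ Ioo (0 : ℝ) 1) :
    1 / x = pq x 1 + gaussMap x := by
  have h : (0 : ℤ) ≤ ⌊1 / x⌋ := Int.floor_nonneg.2 (by have := hx.1; positivity)
  have h2 : ((pq x 1 : ℕ) : ℝ) = (⌊1 / x⌋ : ℤ) := by
    have : ((pq x 1 : ℕ) : ℤ) = ⌊1 / x⌋ := by simpa [pq] using h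
    exact_mod_cast congrArg (Int.cast (R := ℝ)) this
  rw [h2, gaussMap]
  ring

theorem one_le_pq_one {x : ℝ} (hx : x ∈ Ioo (0 : ℝ) 1) : 1 ≤ pq x 1 := by
  have h : (1 : ℤ) ≤ ⌊1 / x⌋ := by
    rw [Int.le_floor, Int.cast_one, le_div_iff₀ hx.1]
    linarith [hx.2]
  have h1 : pq x 1 = ⌊1 / x⌋.toNat := by simp [pq]
  omega

/-- Two points whose first `L` partial quotients agree and are bounded below by `b` are at
distance at most `∏ b_i⁻²`. -/
theorem abs_sub_le_prod_of_pq_eq (L : ℕ) {x y : ℝ} (hx : x ∈ Ioo (0 : ℝ) 1) (hxi : Irrational x)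
    (hy : y ∈ Ioo (0 : ℝ) 1) (hyi : Irrational y) {b : ℕ → ℕ}
    (hxy : ∀ i < L, pq x (i + 1) = pq y (i + 1))
    (hb : ∀ i < L, 0 < b i ∧ b i ≤ pq x (i + 1)) :
    |x - y| ≤ ∏ i ∈ Finset.range L, ((b i : ℝ) ^ 2)⁻¹ := by
  induction L generalizing x y b with
  | zero =>
    simp only [Finset.range_zero, Finset.prod_empty, abs_le]
    constructor <;> linarith [hx.1, hx.2, hy.1, hy.2]
  | succ L ih =>
    have key := ih (b := fun i => b (i + 1)) (gaussMap_mem_Ioo hxi) hxi.gaussMap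
      (gaussMap_mem_Ioo hyi) hyi.gaussMap
      (fun i hi => by simpa only [pq_gaussMap] using hxy (i + 1) (by omega))
      (fun i hi => by simpa only [pq_gaussMap] using hb (i + 1) (by omega))
    obtain ⟨hb0, hbx⟩ := hb 0 (by omega)
    have hxy0 : pq x 1 = pq y 1 := hxy 0 (by omega)
    have hbR : (0 : ℝ) < b 0 := by exact_mod_cast hb0
    have le_inv : ∀ z ∈ Ioo (0 : ℝ) 1, Irrational z → b 0 ≤ pq z 1 → z ≤ (b 0 : ℝ)⁻¹ := by
      intro z hz hzi hbz
      rw [le_inv_comm₀ hz.1 hbR, ← one_div, one_div_eq_pq_add_gaussMap hz]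
      have : (b 0 : ℝ) ≤ pq z 1 := by exact_mod_cast hbz
      linarith [(gaussMap_mem_Ioo hzi).1]
    have hx' := le_inv x hx hxi hbx
    have hy' := le_inv y hy hyi (hxy0 ▸ hbx)
    have e : x - y = (gaussMap y - gaussMap x) * (x * y) := by
      have h1 := one_div_eq_pq_add_gaussMap hx
      have h2 := one_div_eq_pq_add_gaussMap hy
      rw [hxy0] at h1
      have h3 : gaussMap y - gaussMap x = 1 / y - 1 / x := by rw [h1, h2]; ring
      rw [h3]
      have := hx.1.ne'
      have := hy.1.ne'
      field_simp
    rw [e, abs_mul, abs_of_pos (mul_pos hx.1 hy.1), Finset.prod_range_succ', abs_sub_comm]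
    refine mul_le_mul key ?_ (mul_pos hx.1 hy.1).le (Finset.prod_nonneg fun i _ => by positivity)
    rw [sq, mul_inv]
    exact mul_le_mul hx' hy' hy.1.le (by positivity)

theorem succ_le_pq {x : ℝ} (hx : x ∈ Jset) (n : ℕ) : n + 1 ≤ pq x (n + 1) := by
  induction n with
  | zero => exact one_le_pq_one hx.1
  | succ n ih => have := hx.2.2 (n + 1) (by omega); omega

theorem pq_lt_pq {x : ℝ} (hx : x ∈ Jset) {i j : ℕ} (hij : i < j) :
    pq x (i + 1) < pq x (j + 1) := by
  induction j, hij using Nat.le_induction with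
  | base => exact hx.2.2 _ (by omega)
  | succ j _ ih => exact ih.trans (hx.2.2 _ (by omega))

/-! ### Diameters and coverings -/

theorem ediam_le_prod {S : Set ℝ} (hS : S ⊆ Jset) (L : ℕ) {b : ℕ → ℕ}
    (heq : ∀ x ∈ S, ∀ y ∈ S, ∀ i < L, pq x (i + 1) = pq y (i + 1))
    (hb : ∀ i < L, 0 < b i) (hle : ∀ x ∈ S, ∀ i < L, b i ≤ pq x (i + 1)) :
    Metric.ediam S ≤ ∏ i ∈ Finset.range L, ((b i : ℝ≥0∞) ^ 2)⁻¹ := by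
  refine Metric.ediam_le fun x hx y hy => ?_
  have h := abs_sub_le_prod_of_pq_eq L (hS hx).1 (hS hx).2.1 (hS hy).1 (hS hy).2.1
    (heq x hx y hy) (fun i hi => ⟨hb i hi, hle x hx i hi⟩)
  rw [edist_dist, Real.dist_eq]
  refine (ENNReal.ofReal_le_ofReal h).trans_eq ?_
  rw [ENNReal.ofReal_prod_of_nonneg fun i _ => by positivity]
  refine Finset.prod_congr rfl fun i hi => ?_
  have : (0 : ℝ) < b i := by exact_mod_cast hb i (Finset.mem_range.1 hi)
  rw [ENNReal.ofReal_inv_of_pos (by positivity), ENNReal.ofReal_pow this.le,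
    ENNReal.ofReal_natCast]

theorem ediam_rpow_le_prod {S : Set ℝ} (hS : S ⊆ Jset) (L : ℕ) {b : ℕ → ℕ}
    (heq : ∀ x ∈ S, ∀ y ∈ S, ∀ i < L, pq x (i + 1) = pq y (i + 1))
    (hb : ∀ i < L, 0 < b i) (hle : ∀ x ∈ S, ∀ i < L, b i ≤ pq x (i + 1)) {s : ℝ} (hs : 0 ≤ s) :
    Metric.ediam S ^ s ≤ ∏ i ∈ Finset.range L, (b i : ℝ≥0∞) ^ (-(2 * s)) := by
  refine (ENNReal.rpow_le_rpow (ediam_le_prod hS L heq hb hle) hs).trans_eq ?_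
  rw [← ENNReal.prod_rpow_of_nonneg hs]
  refine Finset.prod_congr rfl fun i _ => ?_
  rw [ENNReal.inv_rpow, ENNReal.rpow_neg, ENNReal.rpow_mul, ENNReal.rpow_two]

theorem ediam_le_inv {S : Set ℝ} (hS : S ⊆ Jset) {L N : ℕ} (hN : N ≤ L)
    (heq : ∀ x ∈ S, ∀ y ∈ S, ∀ i < L, pq x (i + 1) = pq y (i + 1)) :
    Metric.ediam S ≤ (N : ℝ≥0∞)⁻¹ := by
  refine (ediam_le_prod (b := fun i => i + 1) hS L heq (fun i _ => by omega)
    (fun x hx i _ => succ_le_pq (hS hx) i)).trans ?_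
  rcases N.eq_zero_or_pos with rfl | hN0
  · simp
  obtain ⟨L, rfl⟩ : ∃ k, L = k + 1 := ⟨L - 1, by omega⟩
  rw [Finset.prod_range_succ]
  have h1 : ∏ i ∈ Finset.range L, (((i + 1 : ℕ) : ℝ≥0∞) ^ 2)⁻¹ ≤ 1 := by
    refine Finset.prod_le_one' fun i _ => ENNReal.inv_le_one.2 (one_le_pow₀ ?_)
    exact_mod_cast Nat.succ_pos i
  refine (mul_le_of_le_one_left zero_le h1).trans (ENNReal.inv_le_inv.2 ?_)
  exact_mod_cast hN.trans (Nat.le_self_pow two_ne_zero _)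

/-- A set with arbitrarily fine coverings whose `s`-dimensional sums stay bounded has dimension at
most `s`. -/
theorem dimH_le_of_coverings {S : Set ℝ} {s : ℝ≥0} {C : ℝ≥0∞} (hC : C ≠ ⊤) {N₀ : ℕ}
    {ι : ℕ → Type} [∀ N, Countable (ι N)] (t : ∀ N, ι N → Set ℝ)
    (hdiam : ∀ N i, Metric.ediam (t N i) ≤ (N : ℝ≥0∞)⁻¹) (hcover : ∀ N, S ⊆ ⋃ i, t N i)
    (hsum : ∀ N, N₀ ≤ N → ∑' i, Metric.ediam (t N i) ^ (s : ℝ) ≤ C) : dimH S ≤ s := by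
  apply dimH_le_of_hausdorffMeasure_ne_top
  refine ne_top_of_le_ne_top hC ?_
  refine (Measure.hausdorffMeasure_le_liminf_tsum (s : ℝ) S (fun N : ℕ => (N : ℝ≥0∞)⁻¹)
    ENNReal.tendsto_inv_nat_nhds_zero t (Eventually.of_forall hdiam)
    (Eventually.of_forall hcover)).trans ?_
  refine liminf_le_of_frequently_le' (Eventually.frequently ?_)
  filter_upwards [eventually_ge_atTop N₀] with N hN using hsum N hN

/-! ### Sums of weights -/

/-- The weight `(k + 1)^(-t)`. -/
noncomputable def powWeight (t : ℝ) (k : ℕ) : ℝ≥0∞ := ((k + 1 : ℕ) : ℝ≥0∞) ^ (-t)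

theorem powWeight_add (s t : ℝ) (k : ℕ) : powWeight (s + t) k = powWeight s k * powWeight t k := by
  rw [powWeight, neg_add, ENNReal.rpow_add _ _ (by simp) (ENNReal.natCast_ne_top _)]
  rfl

theorem powWeight_anti {s t : ℝ} (h : s ≤ t) (k : ℕ) : powWeight t k ≤ powWeight s k :=
  ENNReal.rpow_le_rpow_of_exponent_le (by exact_mod_cast Nat.succ_pos k) (neg_le_neg h)

theorem powWeight_antitone {t : ℝ} (ht : 0 ≤ t) : Antitone (powWeight t) := by
  intro k l h
  rw [powWeight, powWeight, ENNReal.rpow_neg, ENNReal.rpow_neg, ENNReal.inv_le_inv]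
  exact ENNReal.rpow_le_rpow (by exact_mod_cast Nat.succ_le_succ h) ht

theorem powWeight_nat_mul (t : ℝ) (n k : ℕ) : powWeight (n * t) k = powWeight t k ^ n := by
  rw [powWeight, powWeight, ← ENNReal.rpow_natCast, ← ENNReal.rpow_mul]
  congr 1
  ring

theorem tsum_powWeight_ne_top {t : ℝ} (ht : 1 < t) : ∑' k, powWeight t k ≠ ⊤ := by
  have h : ∀ k, powWeight t k = (((k + 1 : ℕ) : ℝ≥0) ^ (-t) : ℝ≥0) := fun k => by
    rw [powWeight, ENNReal.coe_rpow_of_ne_zero (by positivity)]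
    simp
  simp_rw [h]
  rw [ENNReal.tsum_coe_ne_top_iff_summable,
    NNReal.summable_nat_add_iff 1 (f := fun k : ℕ => (k : ℝ≥0) ^ (-t))]
  exact NNReal.summable_rpow.2 (by linarith)

theorem ENNReal.tsum_fin_pi_prod (n : ℕ) (g : Fin n → ℕ → ℝ≥0∞) :
    ∑' f : Fin n → ℕ, ∏ i, g i (f i) = ∏ i, ∑' k, g i k := by
  induction n with
  | zero => simp
  | succ n ih =>
    rw [← (Fin.consEquiv fun _ => ℕ).tsum_eq, ENNReal.tsum_prod', Fin.prod_univ_succ, ← ih,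
      ← ENNReal.tsum_mul_right]
    refine tsum_congr fun k => ?_
    rw [← ENNReal.tsum_mul_left]
    refine tsum_congr fun f => ?_
    simp [Fin.consEquiv, Fin.prod_univ_succ]

theorem powWeight_monotone_of_nonpos {t : ℝ} (ht : t ≤ 0) : Monotone (powWeight t) := fun k l h =>
  ENNReal.rpow_le_rpow (by exact_mod_cast Nat.succ_le_succ h) (neg_nonneg.2 ht)

theorem tendsto_powWeight {t : ℝ} (ht : 0 < t) : Tendsto (powWeight t) atTop (𝓝 0) := by
  have h := (ENNReal.tendsto_inv_nat_nhds_zero.comp (tendsto_add_atTop_nat 1)).ennrpow_const t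
  rw [ENNReal.zero_rpow_of_pos ht] at h
  refine h.congr fun k => ?_
  rw [powWeight, ENNReal.rpow_neg, ← ENNReal.inv_rpow]
  rfl

theorem tsum_powWeight_lt_le {t η : ℝ} (h : t ≤ 1 + η) (m : ℕ) :
    ∑' k, (if k < m then powWeight t k else 0) ≤
      (∑' k, powWeight (1 + η) k) * powWeight (t - 1 - η) m := by
  rw [← ENNReal.tsum_mul_right]
  refine ENNReal.tsum_le_tsum fun k => ?_
  split_ifs with hk
  · calc powWeight t k = powWeight (1 + η) k * powWeight (t - 1 - η) k := by
          rw [← powWeight_add]; congr 1; ring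
      _ ≤ _ := mul_le_mul_right (powWeight_monotone_of_nonpos (by linarith) hk.le) _
  · exact zero_le

/-! ### The set `J` -/

theorem exists_prod_tail_le {t : ℝ} (ht : 1 < t) :
    ∃ C : ℝ≥0∞, C ≠ ⊤ ∧ ∀ N, ∏ i ∈ Finset.range N, ∑' k, powWeight t (k + i) ≤ C := by
  have hfin := tsum_powWeight_ne_top ht
  obtain ⟨M, hM⟩ := eventually_atTop.1 <|
    (ENNReal.tendsto_sum_nat_add _ hfin).eventually (eventually_le_nhds zero_lt_one)
  set T := max 1 (∑' k, powWeight t k) with hT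
  refine ⟨T ^ M, ENNReal.pow_ne_top (max_lt ENNReal.one_lt_top hfin.lt_top).ne, fun N => ?_⟩
  have key : ∏ i ∈ Finset.range N, ∑' k, powWeight t (k + i) ≤ T ^ min N M := by
    induction N with
    | zero => simp
    | succ N ih =>
      rw [Finset.prod_range_succ]
      rcases lt_or_ge N M with h | h
      · rw [min_eq_left h, pow_succ]
        rw [min_eq_left h.le] at ih
        refine mul_le_mul' ih (le_trans ?_ (le_max_right _ _))
        exact ENNReal.tsum_le_tsum fun k => powWeight_antitone (by linarith) (by omega)
      · rw [min_eq_right (by omega)]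
        rw [min_eq_right h] at ih
        exact (mul_le_mul' ih (hM N h)).trans_eq (mul_one _)
  exact key.trans (pow_le_pow_right₀ (le_max_left _ _) (min_le_right _ _))

theorem dimH_Jset_le {s : ℝ≥0} (hs : 1 < 2 * (s : ℝ)) : dimH Jset ≤ s := by
  obtain ⟨C, hC, hle⟩ := exists_prod_tail_le hs
  let t : ∀ N, (Fin N → ℕ) → Set ℝ := fun N f =>
    {x | x ∈ Jset ∧ ∀ i : Fin N, pq x (i + 1) = f i + i + 1}
  have htJ : ∀ N f, t N f ⊆ Jset := fun N f x hx => hx.1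
  have heq : ∀ N f, ∀ x ∈ t N f, ∀ y ∈ t N f, ∀ i < N, pq x (i + 1) = pq y (i + 1) :=
    fun N f x hx y hy i hi => (hx.2 ⟨i, hi⟩).trans (hy.2 ⟨i, hi⟩).symm
  refine dimH_le_of_coverings hC (N₀ := 0) t
    (fun N f => ediam_le_inv (htJ N f) le_rfl (heq N f)) (fun N x hx => ?_) fun N _ => ?_
  · refine mem_iUnion.2 ⟨fun i => pq x (i + 1) - (i + 1), hx, fun i => ?_⟩
    have := succ_le_pq hx i
    rw [add_assoc, Nat.sub_add_cancel this]
  · refine le_trans ?_ (hle N)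
    rw [Finset.prod_range, ← ENNReal.tsum_fin_pi_prod N fun i k => powWeight (2 * s) (k + i)]
    refine ENNReal.tsum_le_tsum fun f => ?_
    refine (ediam_rpow_le_prod (b := fun i => if h : i < N then f ⟨i, h⟩ + i + 1 else 1) (htJ N f)
      N (heq N f) (fun i hi => by simp [hi])
      (fun x hx i hi => by simpa [hi] using (hx.2 ⟨i, hi⟩).ge) s.2).trans_eq ?_
    rw [Finset.prod_range]
    simp [powWeight]

/-! ### Words ending with an arithmetic progression -/

/-- Points of `J` whose first `p` partial quotients are `f i + 1`, and whose next `L` partial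
quotients form the arithmetic progression with first term `m + 1` and difference `d + 1`. -/
def apCylinder (p L m d : ℕ) (f : Fin p → ℕ) : Set ℝ :=
  {x | x ∈ Jset ∧ (∀ i : Fin p, pq x (i + 1) = f i + 1) ∧
    ∀ j < L, pq x (p + j + 1) = m + 1 + j * (d + 1)}

theorem apCylinder_subset (p L m d : ℕ) (f : Fin p → ℕ) : apCylinder p L m d f ⊆ Jset :=
  fun _ hx => hx.1

theorem pq_eq_of_mem_apCylinder {p L m d : ℕ} {f : Fin p → ℕ} {x y : ℝ}
    (hx : x ∈ apCylinder p L m d f) (hy : y ∈ apCylinder p L m d f) {i : ℕ} (hi : i < p + L) :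
    pq x (i + 1) = pq y (i + 1) := by
  rcases lt_or_ge i p with h | h
  · exact (hx.2.1 ⟨i, h⟩).trans (hy.2.1 ⟨i, h⟩).symm
  · obtain ⟨j, rfl⟩ := Nat.exists_eq_add_of_le h
    rw [hx.2.2 j (by omega), hy.2.2 j (by omega)]

theorem exists_mem_apCylinder {x : ℝ} (hx : x ∈ Jset) {p L : ℕ} (h : IsAPAt (pq x) (p + 1) L) :
    ∃ m d f, x ∈ apCylinder p L m d f := by
  obtain ⟨D, hD⟩ := h
  have hf : ∀ i : Fin p, pq x (i + 1) = pq x (i + 1) - 1 + 1 := fun i => by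
    have := succ_le_pq hx i
    omega
  have hm := succ_le_pq hx p
  refine ⟨pq x (p + 1) - 1, (D - 1).toNat, fun i => pq x (i + 1) - 1, hx, hf, fun j hj => ?_⟩
  induction j with
  | zero => simp; omega
  | succ j ih =>
    have h1 := ih (by omega)
    have h2 := hD j (by omega)
    have h3 := hx.2.2 (p + j + 1) (by omega)
    rw [show p + 1 + j + 1 = p + (j + 1) + 1 by omega, show p + 1 + j = p + j + 1 by omega] at h2
    rw [show p + j + 1 + 1 = p + (j + 1) + 1 by omega] at h3
    rw [add_mul, one_mul]
    omega

theorem ediam_apCylinder_rpow_le {p L m d q k : ℕ} {f : Fin p → ℕ} (hL : L = q + k) (hq : 1 ≤ q)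
    {s : ℝ} (hs : 0 ≤ s) (hs0 : s ≠ 0) :
    Metric.ediam (apCylinder p L m d f) ^ s ≤
      if p ≤ m then (∏ i, if f i < m then powWeight (2 * s) (f i) else 0) *
        powWeight (2 * s) m ^ q * powWeight (2 * s) d ^ k else 0 := by
  rcases (apCylinder p L m d f).eq_empty_or_nonempty with he | ⟨x, hx⟩
  · rw [he, Metric.ediam_empty, ENNReal.zero_rpow_of_pos (lt_of_le_of_ne hs hs0.symm)]
    exact zero_le
  have hxm : pq x (p + 1) = m + 1 := by simpa using hx.2.2 0 (by omega)
  have hpm : p ≤ m := by have := succ_le_pq hx.1 p; omega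
  have hfm : ∀ i, f i < m := fun i => by
    have h1 := hx.2.1 i
    have h2 := pq_lt_pq hx.1 i.2
    omega
  simp only [hpm, hfm, if_true]
  refine (ediam_rpow_le_prod (L := p + q + k)
    (b := fun i => if h : i < p then f ⟨i, h⟩ + 1 else if i < p + q then m + 1 else d + 1)
    (apCylinder_subset _ _ _ _ _)
    (fun x hx y hy i hi => pq_eq_of_mem_apCylinder hx hy (by omega))
    (fun i _ => ?_) (fun y hy i hi => ?_) hs).trans_eq ?_
  · split_ifs <;> omega
  · split_ifs with h1 h2
    · exact (hy.2.1 ⟨i, h1⟩).ge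
    · obtain ⟨j, rfl⟩ := Nat.exists_eq_add_of_le (not_lt.1 h1)
      rw [hy.2.2 j (by omega)]
      omega
    · obtain ⟨j, rfl⟩ := Nat.exists_eq_add_of_le (not_lt.1 h1)
      rw [hy.2.2 j (by omega)]
      have : 1 * (d + 1) ≤ j * (d + 1) := Nat.mul_le_mul_right _ (by omega)
      omega
  · rw [Finset.prod_range_add, Finset.prod_range_add]
    congr 1
    · congr 1
      · rw [Finset.prod_range]
        simp [powWeight]
      · rw [Finset.prod_congr rfl (g := fun _ => powWeight (2 * s) m), Finset.prod_const,
          Finset.card_range]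
        intro i hi
        have := Finset.mem_range.1 hi
        simp [powWeight, this]
    · rw [Finset.prod_congr rfl (g := fun _ => powWeight (2 * s) d), Finset.prod_const,
        Finset.card_range]
      intro i _
      simp [powWeight, add_assoc]

theorem tsum_ediam_apCylinder_le {p L q k : ℕ} (hL : L = q + k) (hq : 1 ≤ q) {s η : ℝ}
    (hs : 0 < s) (hη : 0 ≤ η) (hsη : 2 * s ≤ 1 + η)
    (hexp : η * p + 2 ≤ p * (2 * s - 1 - η) + q * (2 * s)) :
    ∑' c : ℕ × ℕ × (Fin p → ℕ), Metric.ediam (apCylinder p L c.1 c.2.1 c.2.2) ^ s ≤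
      ((∑' k, powWeight (1 + η) k) * powWeight η p) ^ p * (∑' m, powWeight 2 m) *
        ∑' d, powWeight (k * (2 * s)) d := by
  have hbound := tsum_powWeight_lt_le (t := 2 * s) hsη
  generalize ∑' k, powWeight (1 + η) k = Z at hbound ⊢
  calc ∑' c : ℕ × ℕ × (Fin p → ℕ), Metric.ediam (apCylinder p L c.1 c.2.1 c.2.2) ^ s
      = ∑' (m) (d) (f), Metric.ediam (apCylinder p L m d f) ^ s := by
        simp_rw [ENNReal.tsum_prod']
    _ ≤ ∑' (m) (d), (Z * powWeight η p) ^ p * powWeight 2 m * powWeight (k * (2 * s)) d :=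
        ENNReal.tsum_le_tsum fun m => ENNReal.tsum_le_tsum fun d => ?_
    _ = _ := by simp_rw [ENNReal.tsum_mul_left, ENNReal.tsum_mul_right, ENNReal.tsum_mul_left]
  refine (ENNReal.tsum_le_tsum fun f => ediam_apCylinder_rpow_le hL hq hs.le hs.ne').trans ?_
  split_ifs with hpm
  · rw [ENNReal.tsum_mul_right, ENNReal.tsum_mul_right,
      ENNReal.tsum_fin_pi_prod p fun _ k => if k < m then powWeight (2 * s) k else 0,
      Finset.prod_const, Finset.card_univ, Fintype.card_fin, ← powWeight_nat_mul _ k]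
    refine mul_le_mul_left ?_ _
    calc (∑' k, if k < m then powWeight (2 * s) k else 0) ^ p * powWeight (2 * s) m ^ q
        ≤ (Z * powWeight (2 * s - 1 - η) m) ^ p * powWeight (2 * s) m ^ q := by
          gcongr
          exact hbound m
      _ = Z ^ p * powWeight (p * (2 * s - 1 - η) + q * (2 * s)) m := by
          rw [mul_pow, powWeight_add, powWeight_nat_mul, powWeight_nat_mul, mul_assoc]
      _ ≤ Z ^ p * powWeight (p * η + 2) m := by
          gcongr
          exact powWeight_anti (by linarith) m
      _ ≤ (Z * powWeight η p) ^ p * powWeight 2 m := by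
          rw [powWeight_add, powWeight_nat_mul, ← mul_assoc, ← mul_pow]
          gcongr
          exact powWeight_antitone hη hpm
  · simp

/-- The dimension bound for `F`, in terms of a linear lower bound `β n` for `ν n`. -/
theorem dimH_Fset_le {ν : ℕ → ℕ} {β : ℝ} (hβ : ∀ᶠ n : ℕ in atTop, β * n ≤ ν n) {s : ℝ≥0}
    (hs1 : 2 * (s : ℝ) ≤ 1) (hs : 1 < 2 * s * (1 + β)) : dimH (Fset ν) ≤ s := by
  have hs0 : (0 : ℝ) < s := by
    refine lt_of_le_of_ne s.2 fun h => ?_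
    rw [← h] at hs
    norm_num at hs
  have hβ0 : 0 < β := by nlinarith
  set η : ℝ := (2 * s * (1 + β) - 1) / 3 with hηdef
  have hη : 0 < η := by rw [hηdef]; linarith
  obtain ⟨k, hk⟩ := exists_nat_gt (1 / (2 * (s : ℝ)))
  rw [div_lt_iff₀ (by positivity)] at hk
  set Z := ∑' k, powWeight (1 + η) k with hZ
  have hZtop : Z ≠ ⊤ := tsum_powWeight_ne_top (by linarith)
  set D := (∑' m, powWeight 2 m) * ∑' d, powWeight (k * (2 * s)) d with hD
  have hDtop : D ≠ ⊤ :=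
    ENNReal.mul_ne_top (tsum_powWeight_ne_top (by norm_num)) (tsum_powWeight_ne_top hk)
  have hhalf : ∀ᶠ p : ℕ in atTop, Z * powWeight η p ≤ 2⁻¹ := by
    have h := ENNReal.Tendsto.const_mul (a := Z) (tendsto_powWeight hη) (Or.inr hZtop)
    rw [mul_zero] at h
    exact h.eventually (eventually_le_nhds (by simp))
  have hlin : ∀ c : ℝ, ∀ γ > 0, ∀ᶠ p : ℕ in atTop, c ≤ γ * p := fun c γ hγ =>
    (tendsto_natCast_atTop_atTop.const_mul_atTop hγ).eventually_ge_atTop c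
  obtain ⟨N₀, hN₀⟩ := eventually_atTop.1 <| (hhalf.and (hlin (k * (2 * s) + 2) η hη)).and <|
    (hlin (k + 1) β hβ0).and ((tendsto_add_atTop_nat 1).eventually hβ)
  let t : ∀ N, (Σ r : ℕ, ℕ × ℕ × (Fin (N + r) → ℕ)) → Set ℝ := fun N c =>
    apCylinder (N + c.1) (ν (N + c.1 + 1)) c.2.1 c.2.2.1 c.2.2.2
  refine dimH_le_of_coverings (C := 2 * D) (ENNReal.mul_ne_top (by simp) hDtop) (N₀ := N₀) t
    (fun N c => ?_) (fun N x hx => ?_) fun N hN => ?_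
  · exact ediam_le_inv (L := N + c.1 + ν (N + c.1 + 1)) (apCylinder_subset _ _ _ _ _) (by omega)
      fun x hx y hy i hi => pq_eq_of_mem_apCylinder hx hy hi
  · obtain ⟨n, hn, -, hap⟩ := hx.2 (N + 1)
    obtain ⟨r, rfl⟩ : ∃ r, n = N + r + 1 := ⟨n - N - 1, by omega⟩
    obtain ⟨m, d, f, h⟩ := exists_mem_apCylinder hx.1 hap
    exact mem_iUnion.2 ⟨⟨r, m, d, f⟩, h⟩
  · rw [ENNReal.tsum_sigma']
    calc ∑' (r : ℕ) (c : ℕ × ℕ × (Fin (N + r) → ℕ)), Metric.ediam (t N ⟨r, c⟩) ^ (s : ℝ)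
        ≤ ∑' r : ℕ, 2⁻¹ ^ r * D := by
          refine ENNReal.tsum_le_tsum fun r => ?_
          obtain ⟨⟨h1, h2⟩, h3, h4⟩ := hN₀ (N + r) (by omega)
          rw [Nat.cast_succ] at h4
          have hkν : k + 1 ≤ ν (N + r + 1) := by
            have : ((k + 1 : ℕ) : ℝ) ≤ ν (N + r + 1) := by
              push_cast at *
              linarith
            exact_mod_cast this
          obtain ⟨q, hq⟩ := Nat.exists_eq_add_of_le' (Nat.le_of_succ_le hkν)
          refine (tsum_ediam_apCylinder_le (η := η) hq (by omega) hs0 hη.le (by linarith)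
            ?_).trans ?_
          · rw [hq] at h4
            push_cast at h2 h4 ⊢
            have h5 := mul_le_mul_of_nonneg_left h4 (by positivity : (0 : ℝ) ≤ 2 * s)
            have h6 : 3 * η = 2 * s * (1 + β) - 1 := by rw [hηdef]; ring
            have h7 : (0 : ℝ) ≤ 2 * s * β := by positivity
            have h8 : 3 * η * (N + r) = (2 * s * (1 + β) - 1) * (N + r) := by rw [h6]
            linarith
          · rw [mul_assoc, ← hD]
            refine mul_le_mul_left ((pow_le_pow_left' h1 _).trans ?_) _
            exact pow_le_pow_right_of_le_one' (by simp) (by omega)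
      _ = 2 * D := by
          rw [ENNReal.tsum_mul_right, ENNReal.tsum_geometric, ENNReal.one_sub_inv_two, inv_inv]

/-- Proposition 3.1 (upper bound): `dim_H F((ν_n)) ≤ 1/(2(1+α))` where
`α = liminf ν_n / n < ∞`. -/
theorem stmt4 (ν : ℕ → ℕ) (hν1 : ∀ n, 1 ≤ ν n) (hmono : Monotone ν)
    (α : ℝ≥0∞) (hα : α = Filter.liminf (fun n : ℕ => (ν n : ℝ≥0∞) / (n : ℝ≥0∞)) Filter.atTop)
    (hfin : α ≠ ⊤) :
    dimH (Fset ν) ≤ 1 / (2 * (1 + α)) := by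
  refine le_of_forall_gt_imp_ge_of_dense fun c hc => ?_
  obtain ⟨s, hs, hsc⟩ := ENNReal.lt_iff_exists_nnreal_btwn.1 hc
  refine le_trans ?_ hsc.le
  lift α to ℝ≥0 using hfin
  have hs' : 1 < 2 * (s : ℝ) * (1 + α) := by
    have h : (1 / (2 * (1 + α)) : ℝ≥0) < s := by
      rw [← ENNReal.coe_lt_coe, ENNReal.coe_div (by positivity)]
      simpa using hs
    rw [div_lt_iff₀ (by positivity), ← NNReal.coe_lt_coe] at h
    push_cast at h
    linarith
  rcases lt_or_ge 1 (2 * (s : ℝ)) with h1 | h1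
  · exact (dimH_mono fun x hx => hx.1).trans (dimH_Jset_le h1)
  have hs0 : (0 : ℝ) < s := by
    refine lt_of_le_of_ne s.2 fun h => ?_
    rw [← h] at hs'
    norm_num at hs'
  obtain ⟨β, hβ, hβα⟩ : ∃ β : ℝ, 1 / (2 * s) - 1 < β ∧ β < α := by
    refine exists_between ?_
    rw [sub_lt_iff_lt_add, div_lt_iff₀ (by positivity)]
    linarith
  rw [sub_lt_iff_lt_add, div_lt_iff₀ (by positivity)] at hβ
  have hβ0 : 0 ≤ β := by nlinarith
  lift β to ℝ≥0 using hβ0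
  refine dimH_Fset_le (β := β) ?_ h1 (by linarith)
  have hlt : (β : ℝ≥0∞) < liminf (fun n : ℕ => (ν n : ℝ≥0∞) / (n : ℝ≥0∞)) atTop := by
    rw [← hα]
    exact_mod_cast hβα
  filter_upwards [eventually_lt_of_lt_liminf hlt] with n hn
  have h := ENNReal.mul_le_of_le_div hn.le
  exact_mod_cast h
end

section
/- Let (ν_n)_{n≥1} be a non-decreasing sequence of positive integers and set α = liminf_{n→∞} ν_n/n. If α < ∞, then the Hausdorff dimension of F((ν_n)) is at least 1/(2(1+α)). -/
open Filter MeasureTheory Set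
open scoped ENNReal NNReal Topology

/-- The set of points `1/(a₀ + 1/(a₁ + ⋯ + 1/(a_{n-1} + t)))` with `t ∈ [0,1]`. -/
def cfCylinder : ℕ → (ℕ → ℕ) → Set ℝ
  | 0, _ => Icc 0 1
  | n + 1, a => (fun t : ℝ => 1 / ((a 0 : ℝ) + t)) '' cfCylinder n (fun i => a (i + 1))

lemma cfCylinder_succ_subset (n : ℕ) (a : ℕ → ℕ) (ha : ∀ i, 1 ≤ a i) :
    cfCylinder (n + 1) a ⊆ cfCylinder n a := by
  induction n generalizing a with
  | zero =>
    rintro _ ⟨t, ht, rfl⟩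
    have h1 : (1 : ℝ) ≤ a 0 := by exact_mod_cast ha 0
    have ht0 : 0 ≤ t := ht.1
    refine ⟨by positivity, ?_⟩
    rw [div_le_one (by positivity)]
    linarith
  | succ n ih => exact image_mono (ih _ fun i => ha (i + 1))

lemma cfCylinder_subset_Icc (n : ℕ) (a : ℕ → ℕ) (ha : ∀ i, 1 ≤ a i) :
    cfCylinder n a ⊆ Icc 0 1 := by
  induction n with
  | zero => exact subset_rfl
  | succ n ih => exact (cfCylinder_succ_subset n a ha).trans ih

lemma isCompact_cfCylinder (n : ℕ) (a : ℕ → ℕ) (ha : ∀ i, 1 ≤ a i) :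
    IsCompact (cfCylinder n a) := by
  induction n generalizing a with
  | zero => exact isCompact_Icc
  | succ n ih =>
    refine (ih _ fun i => ha (i + 1)).image_of_continuousOn ?_
    refine continuousOn_const.div (by fun_prop) fun t ht => ?_
    have h1 : (1 : ℝ) ≤ a 0 := by exact_mod_cast ha 0
    have ht0 := (cfCylinder_subset_Icc n _ (fun i => ha (i + 1)) ht).1
    linarith

lemma cfCylinder_nonempty (n : ℕ) (a : ℕ → ℕ) : (cfCylinder n a).Nonempty := by
  induction n generalizing a with
  | zero => exact ⟨0, by simp [cfCylinder]⟩
  | succ n ih => exact (ih _).image _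

lemma iInter_cfCylinder_nonempty (a : ℕ → ℕ) (ha : ∀ i, 1 ≤ a i) :
    (⋂ n, cfCylinder n a).Nonempty :=
  IsCompact.nonempty_iInter_of_sequence_nonempty_isCompact_isClosed _
    (fun n => cfCylinder_succ_subset n a ha) (fun n => cfCylinder_nonempty n a)
    (isCompact_cfCylinder 0 a ha) fun n => (isCompact_cfCylinder n a ha).isClosed

lemma exists_eq_of_mem_iInter_cfCylinder {a : ℕ → ℕ} {x : ℝ} (hx : x ∈ ⋂ n, cfCylinder n a) :
    ∃ y ∈ ⋂ n, cfCylinder n (fun i => a (i + 1)), x = 1 / ((a 0 : ℝ) + y) := by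
  rw [mem_iInter] at hx
  have key (n : ℕ) : 1 / x - a 0 ∈ cfCylinder n (fun i => a (i + 1)) := by
    obtain ⟨t, ht, rfl⟩ := hx (n + 1)
    simpa using ht
  refine ⟨1 / x - a 0, mem_iInter.2 key, ?_⟩
  simp

lemma mem_Ioo_of_mem_iInter_cfCylinder {a : ℕ → ℕ} (ha : ∀ i, 1 ≤ a i) {x : ℝ}
    (hx : x ∈ ⋂ n, cfCylinder n a) : x ∈ Ioo 0 1 := by
  have pos : ∀ (b : ℕ → ℕ), (∀ i, 1 ≤ b i) → ∀ y ∈ ⋂ n, cfCylinder n b, 0 < y := by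
    intro b hb y hy
    obtain ⟨z, hz, rfl⟩ := exists_eq_of_mem_iInter_cfCylinder hy
    have h1 : (1 : ℝ) ≤ b 0 := by exact_mod_cast hb 0
    have h2 : 0 ≤ z := (mem_iInter.1 hz 0).1
    positivity
  refine ⟨pos a ha x hx, ?_⟩
  obtain ⟨z, hz, rfl⟩ := exists_eq_of_mem_iInter_cfCylinder hx
  have h1 : (1 : ℝ) ≤ a 0 := by exact_mod_cast ha 0
  have h2 : 0 < z := pos _ (fun i => ha (i + 1)) z hz
  rw [div_lt_one (by positivity)]
  linarith

lemma floor_one_div_eq {a : ℕ} {y : ℝ} (hy : y ∈ Ioo (0 : ℝ) 1) :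
    ⌊1 / (1 / ((a : ℝ) + y))⌋ = a := by
  rw [one_div_one_div, Int.floor_eq_iff]
  simp [hy.1.le, hy.2]

lemma gaussMap_one_div {a : ℕ} {y : ℝ} (hy : y ∈ Ioo (0 : ℝ) 1) :
    gaussMap (1 / ((a : ℝ) + y)) = y := by
  rw [gaussMap, floor_one_div_eq hy]
  simp

/-- Every sequence of positive integers is the sequence of partial quotients of some point, here
in the form of the recursion satisfied by the orbit under the Gauss map. -/
lemma exists_orbit (a : ℕ → ℕ) (ha : ∀ i, 1 ≤ a i) :
    ∃ x : ℝ, ∀ n, gaussMap^[n] x ∈ Ioo 0 1 ∧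
      gaussMap^[n] x = 1 / ((a n : ℝ) + gaussMap^[n + 1] x) := by
  obtain ⟨x, hx⟩ := iInter_cfCylinder_nonempty a ha
  have step (b : ℕ → ℕ) (hb : ∀ i, 1 ≤ b i) (y : ℝ) (hy : y ∈ ⋂ n, cfCylinder n b) :
      gaussMap y ∈ ⋂ n, cfCylinder n (fun i => b (i + 1)) ∧ y = 1 / ((b 0 : ℝ) + gaussMap y) := by
    obtain ⟨z, hz, rfl⟩ := exists_eq_of_mem_iInter_cfCylinder hy
    rw [gaussMap_one_div (mem_Ioo_of_mem_iInter_cfCylinder (fun i => hb (i + 1)) hz)]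
    exact ⟨hz, rfl⟩
  have mem (n : ℕ) : gaussMap^[n] x ∈ ⋂ k, cfCylinder k (fun i => a (i + n)) := by
    induction n with
    | zero => simpa using hx
    | succ n ih =>
      rw [Function.iterate_succ_apply']
      have := (step _ (fun i => ha (i + n)) _ ih).1
      simpa only [add_assoc, add_comm 1] using this
  refine ⟨x, fun n => ⟨mem_Ioo_of_mem_iInter_cfCylinder (fun i => ha (i + n)) (mem n), ?_⟩⟩
  rw [Function.iterate_succ_apply']
  simpa using (step _ (fun i => ha (i + n)) _ (mem n)).2

lemma pq_succ_eq {a : ℕ → ℕ} {x : ℝ}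
    (hx : ∀ n, gaussMap^[n] x ∈ Ioo 0 1 ∧
      gaussMap^[n] x = 1 / ((a n : ℝ) + gaussMap^[n + 1] x)) (n : ℕ) : pq x (n + 1) = a n := by
  rw [pq, Nat.add_sub_cancel, (hx n).2, floor_one_div_eq (hx (n + 1)).1, Int.toNat_natCast]

lemma abs_one_div_sub_one_div {p q : ℝ} (hp : 0 < p) (hq : 0 < q) :
    |1 / p - 1 / q| = |p - q| / (p * q) := by
  rw [div_sub_div _ _ hp.ne' hq.ne', abs_div, abs_of_pos (mul_pos hp hq), one_mul, mul_one,
    abs_sub_comm]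

/-- Two continued fractions that agree up to index `n` are at least as far apart as their tails,
up to the square of the product of the (shifted) common digits. -/
lemma abs_sub_tail_le {u v : ℕ → ℝ} {a b : ℕ → ℕ}
    (hu : ∀ n, u n ∈ Ioo (0 : ℝ) 1 ∧ u n = 1 / ((a n : ℝ) + u (n + 1)))
    (hv : ∀ n, v n ∈ Ioo (0 : ℝ) 1 ∧ v n = 1 / ((b n : ℝ) + v (n + 1)))
    (n : ℕ) (hab : ∀ i < n, a i = b i) :
    |u n - v n| ≤ |u 0 - v 0| * (∏ i ∈ Finset.range n, ((a i : ℝ) + 1)) ^ 2 := by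
  induction n with
  | zero => simp
  | succ n ih =>
    have hab' := hab n n.lt_succ_self
    have hu1 := (hu (n + 1)).1
    have hv1 := (hv (n + 1)).1
    have ha0 : (0 : ℝ) ≤ a n := Nat.cast_nonneg _
    have hp : 0 < (a n : ℝ) + u (n + 1) := by linarith [hu1.1]
    have hq : 0 < (a n : ℝ) + v (n + 1) := by linarith [hv1.1]
    have h : |u n - v n| = |u (n + 1) - v (n + 1)| /
        (((a n : ℝ) + u (n + 1)) * ((a n : ℝ) + v (n + 1))) := by
      rw [(hu n).2, (hv n).2, ← hab', abs_one_div_sub_one_div hp hq]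
      congr 2
      ring
    have h2 : |u (n + 1) - v (n + 1)| =
        |u n - v n| * (((a n : ℝ) + u (n + 1)) * ((a n : ℝ) + v (n + 1))) := by
      rw [h]; field_simp
    have h3 : ((a n : ℝ) + u (n + 1)) * ((a n : ℝ) + v (n + 1)) ≤ ((a n : ℝ) + 1) ^ 2 := by
      rw [sq]
      exact mul_le_mul (by linarith [hu1.2]) (by linarith [hv1.2]) hq.le (by linarith)
    rw [Finset.prod_range_succ, mul_pow, ← mul_assoc, h2]
    exact mul_le_mul (ih fun i hi => hab i (by omega)) h3 (by positivity) (by positivity)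

/-- The distance of two continued fractions whose digits lie in the consecutive blocks
`[t i, t (i + 1))` and differ first at index `n`. -/
lemma one_le_abs_sub_mul {u v : ℕ → ℝ} {a b t : ℕ → ℕ}
    (hu : ∀ n, u n ∈ Ioo (0 : ℝ) 1 ∧ u n = 1 / ((a n : ℝ) + u (n + 1)))
    (hv : ∀ n, v n ∈ Ioo (0 : ℝ) 1 ∧ v n = 1 / ((b n : ℝ) + v (n + 1)))
    (ht : ∀ n, 2 ≤ t (n + 1))
    (ha : ∀ n, t n ≤ a n ∧ a n < t (n + 1)) (hb : ∀ n, t n ≤ b n ∧ b n < t (n + 1))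
    (n : ℕ) (hab : ∀ i < n, a i = b i) (hne : a n ≠ b n) :
    1 ≤ |u 0 - v 0| * (2 * (∏ i ∈ Finset.range (n + 1), (t (i + 1) : ℝ)) ^ 2) := by
  have half {w : ℕ → ℝ} {c : ℕ → ℕ}
      (hw : ∀ n, w n ∈ Ioo (0 : ℝ) 1 ∧ w n = 1 / ((c n : ℝ) + w (n + 1)))
      (hc : ∀ n, t n ≤ c n ∧ c n < t (n + 1)) : w (n + 1) ≤ 1 / 2 := by
    rw [(hw (n + 1)).2]
    have h2 : (2 : ℝ) ≤ c (n + 1) := by exact_mod_cast (ht n).trans (hc (n + 1)).1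
    exact one_div_le_one_div_of_le two_pos (by linarith [(hw (n + 1 + 1)).1.1])
  have hu2 := half hu ha
  have hv2 := half hv hb
  have hu1 := (hu (n + 1)).1
  have hv1 := (hv (n + 1)).1
  have ha0 : (0 : ℝ) ≤ a n := Nat.cast_nonneg _
  have hb0 : (0 : ℝ) ≤ b n := Nat.cast_nonneg _
  have hp : 0 < (a n : ℝ) + u (n + 1) := by linarith [hu1.1]
  have hq : 0 < (b n : ℝ) + v (n + 1) := by linarith [hv1.1]
  have h1 : (1 : ℝ) / 2 ≤ |(a n + u (n + 1)) - (b n + v (n + 1))| := by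
    rcases lt_or_gt_of_ne hne with h | h
    · have : (a n : ℝ) + 1 ≤ b n := by exact_mod_cast h
      rw [abs_sub_comm]
      exact le_trans (by linarith [hv1.1]) (le_abs_self _)
    · have : (b n : ℝ) + 1 ≤ a n := by exact_mod_cast h
      exact le_trans (by linarith [hu1.1]) (le_abs_self _)
  have hat : (a n : ℝ) + 1 ≤ t (n + 1) := by exact_mod_cast (ha n).2
  have hbt : (b n : ℝ) + 1 ≤ t (n + 1) := by exact_mod_cast (hb n).2
  have h2 : (1 : ℝ) / 2 ≤ |u n - v n| * (t (n + 1) : ℝ) ^ 2 := by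
    have h : |u n - v n| * (((a n : ℝ) + u (n + 1)) * ((b n : ℝ) + v (n + 1))) =
        |(a n + u (n + 1)) - (b n + v (n + 1))| := by
      rw [(hu n).2, (hv n).2, abs_one_div_sub_one_div hp hq]
      field_simp
    refine (h1.trans h.ge).trans (mul_le_mul_of_nonneg_left ?_ (abs_nonneg _))
    rw [sq]
    exact mul_le_mul (by linarith [hu1.2]) (by linarith [hv1.2]) hq.le (by linarith)
  have h3 := abs_sub_tail_le hu hv n hab
  have h4 : ∏ i ∈ Finset.range n, ((a i : ℝ) + 1) ≤ ∏ i ∈ Finset.range n, (t (i + 1) : ℝ) :=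
    Finset.prod_le_prod (fun i _ => by positivity) fun i _ => by exact_mod_cast (ha i).2
  have h5 : |u n - v n| ≤ |u 0 - v 0| * (∏ i ∈ Finset.range n, (t (i + 1) : ℝ)) ^ 2 :=
    h3.trans (mul_le_mul_of_nonneg_left
      (pow_le_pow_left₀ (Finset.prod_nonneg fun i _ => by positivity) h4 2) (abs_nonneg _))
  rw [Finset.prod_range_succ, mul_pow]
  nlinarith [mul_le_mul_of_nonneg_right h5 (sq_nonneg (t (n + 1) : ℝ))]

/-- If a map on `[0,1)` expands distances in the sense of an inverse Hölder condition with
exponent `r`, then its image has dimension at least `r`. -/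
lemma le_dimH_image_Ico {g : ℝ → ℝ} {r C : ℝ≥0} (hr : 0 < r)
    (hg : ∀ x ∈ Ico (0 : ℝ) 1, ∀ y ∈ Ico (0 : ℝ) 1, x ≠ y → |x - y| ≤ C * |g x - g y| ^ (r : ℝ)) :
    (r : ℝ≥0∞) ≤ dimH (g '' Ico 0 1) := by
  have hinj : InjOn g (Ico 0 1) := by
    intro x hx y hy hxy
    by_contra hne
    have h := hg x hx y hy hne
    rw [hxy, sub_self, abs_zero, Real.zero_rpow (by exact_mod_cast hr.ne'), mul_zero] at h
    exact hne (sub_eq_zero.1 (abs_eq_zero.1 (le_antisymm h (abs_nonneg _))))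
  have hleft := hinj.leftInvOn_invFunOn
  have hholder : HolderOnWith C r (Function.invFunOn g (Ico 0 1)) (g '' Ico 0 1) := by
    rintro _ ⟨x, hx, rfl⟩ _ ⟨y, hy, rfl⟩
    rw [hleft hx, hleft hy]
    by_cases hxy : x = y
    · simp [hxy]
    have h := hg x hx y hy hxy
    rw [edist_dist, edist_dist, Real.dist_eq, Real.dist_eq,
      ENNReal.ofReal_rpow_of_nonneg (abs_nonneg _) r.coe_nonneg, ← ENNReal.ofReal_coe_nnreal,
      ← ENNReal.ofReal_mul C.coe_nonneg]
    exact ENNReal.ofReal_le_ofReal h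
  have h := hholder.dimH_image_le hr
  rw [hleft.image_image, Real.dimH_of_nonempty_interior (by simp)] at h
  have h1 : (r : ℝ≥0∞) ≠ 0 := by exact_mod_cast hr.ne'
  simpa using (ENNReal.le_div_iff_mul_le (Or.inl h1) (Or.inl ENNReal.coe_ne_top)).1 h

/-- The digits of `θ` in the mixed radix system with bases `c`. -/
noncomputable def radixDigit (c : ℕ → ℕ) (θ : ℝ) (n : ℕ) : ℕ :=
  ⌊((∏ i ∈ Finset.range (n + 1), c i : ℕ) : ℝ) * θ⌋₊ -
    c n * ⌊((∏ i ∈ Finset.range n, c i : ℕ) : ℝ) * θ⌋₊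

lemma mul_floor_add_radixDigit (c : ℕ → ℕ) {θ : ℝ} (hθ : 0 ≤ θ) (n : ℕ) :
    ⌊((∏ i ∈ Finset.range (n + 1), c i : ℕ) : ℝ) * θ⌋₊ =
      c n * ⌊((∏ i ∈ Finset.range n, c i : ℕ) : ℝ) * θ⌋₊ + radixDigit c θ n := by
  rw [radixDigit, Nat.add_sub_cancel']
  apply Nat.le_floor
  have h := Nat.floor_le (a := ((∏ i ∈ Finset.range n, c i : ℕ) : ℝ) * θ) (by positivity)
  rw [Finset.prod_range_succ]
  push_cast at h ⊢
  nlinarith [mul_le_mul_of_nonneg_left h (Nat.cast_nonneg (α := ℝ) (c n))]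

lemma radixDigit_lt {c : ℕ → ℕ} {θ : ℝ} (hθ : 0 ≤ θ) (n : ℕ) (hc : 0 < c n) :
    radixDigit c θ n < c n := by
  have h0 := mul_floor_add_radixDigit c hθ n
  have h1 := Nat.lt_floor_add_one (((∏ i ∈ Finset.range n, c i : ℕ) : ℝ) * θ)
  have h2 := Nat.floor_le (a := ((∏ i ∈ Finset.range (n + 1), c i : ℕ) : ℝ) * θ) (by positivity)
  rw [h0, Finset.prod_range_succ] at h2
  push_cast at h1 h2
  have h3 : (0 : ℝ) < c n := by exact_mod_cast hc
  have h4 := mul_lt_mul_of_pos_left h1 h3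
  have h5 : (radixDigit c θ n : ℝ) < c n := by linarith
  exact_mod_cast h5

lemma floor_eq_of_radixDigit_eq {c : ℕ → ℕ} {θ η : ℝ} (hθ : θ ∈ Ico (0 : ℝ) 1)
    (hη : η ∈ Ico (0 : ℝ) 1) (n : ℕ) (h : ∀ i < n, radixDigit c θ i = radixDigit c η i) :
    ⌊((∏ i ∈ Finset.range n, c i : ℕ) : ℝ) * θ⌋₊ =
      ⌊((∏ i ∈ Finset.range n, c i : ℕ) : ℝ) * η⌋₊ := by
  induction n with
  | zero => simp [Nat.floor_eq_zero.2 hθ.2, Nat.floor_eq_zero.2 hη.2]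
  | succ n ih =>
    rw [mul_floor_add_radixDigit c hθ.1, mul_floor_add_radixDigit c hη.1,
      ih fun i hi => h i (by omega), h n (by omega)]

lemma abs_sub_mul_le_of_radixDigit_eq {c : ℕ → ℕ} {θ η : ℝ} (hθ : θ ∈ Ico (0 : ℝ) 1)
    (hη : η ∈ Ico (0 : ℝ) 1) (n : ℕ) (h : ∀ i < n, radixDigit c θ i = radixDigit c η i) :
    |θ - η| * (∏ i ∈ Finset.range n, c i : ℕ) ≤ 1 := by
  have h0 := floor_eq_of_radixDigit_eq hθ hη n h
  set P : ℝ := ((∏ i ∈ Finset.range n, c i : ℕ) : ℝ)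
  have hP : 0 ≤ P := Nat.cast_nonneg _
  have h1 := Nat.lt_floor_add_one (P * θ)
  have h2 := Nat.floor_le (mul_nonneg hP hθ.1)
  have h3 := Nat.lt_floor_add_one (P * η)
  have h4 := Nat.floor_le (mul_nonneg hP hη.1)
  rw [h0] at h1 h2
  rw [← abs_of_nonneg hP, ← abs_mul, abs_le]
  constructor <;> nlinarith

/-- The set of points with increasing partial quotients such that the `(i+1)`-st partial quotient
lies in `[t i, t (i + 1))`. -/
def blockSet (t : ℕ → ℕ) : Set ℝ :=
  {x | x ∈ Jset ∧ ∀ i, t i ≤ pq x (i + 1) ∧ pq x (i + 1) < t (i + 1)}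

lemma le_dimH_blockSet {t : ℕ → ℕ} (ht : StrictMono t) (ht0 : 1 ≤ t 0) {r C : ℝ≥0} (hr : 0 < r)
    (H : ∀ n, (∏ i ∈ Finset.range (n + 1), (t (i + 1) : ℝ)) ^ (2 * r : ℝ) ≤
      C * (∏ i ∈ Finset.range n, (t (i + 1) - t i) : ℕ)) :
    (r : ℝ≥0∞) ≤ dimH (blockSet t) := by
  set c : ℕ → ℕ := fun i => t (i + 1) - t i with hc
  have hcpos (i : ℕ) : 0 < c i := Nat.sub_pos_of_lt (ht i.lt_succ_self)
  have ht2 (n : ℕ) : 2 ≤ t (n + 1) := by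
    have := ht n.lt_add_one
    have := ht.monotone n.zero_le
    omega
  have hdig (θ : ℝ) (hθ : θ ∈ Ico (0 : ℝ) 1) (n : ℕ) :
      t n ≤ t n + radixDigit c θ n ∧ t n + radixDigit c θ n < t (n + 1) := by
    have h1 := radixDigit_lt hθ.1 n (hcpos n)
    have h2 := ht n.lt_succ_self
    simp only [hc] at h1 ⊢
    omega
  have hex (θ : ℝ) : ∃ x : ℝ, θ ∈ Ico (0 : ℝ) 1 → ∀ n, gaussMap^[n] x ∈ Ioo 0 1 ∧
      gaussMap^[n] x = 1 / (((t n + radixDigit c θ n : ℕ) : ℝ) + gaussMap^[n + 1] x) := by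
    by_cases hθ : θ ∈ Ico (0 : ℝ) 1
    · obtain ⟨x, hx⟩ := exists_orbit (fun n => t n + radixDigit c θ n) fun n =>
        (ht0.trans (ht.monotone n.zero_le)).trans (hdig θ hθ n).1
      exact ⟨x, fun _ => hx⟩
    · exact ⟨0, fun h => absurd h hθ⟩
  choose g hg using hex
  have hC0 : 0 < C := by
    have h := H 0
    have h2 : (0 : ℝ) < (∏ i ∈ Finset.range (0 + 1), (t (i + 1) : ℝ)) ^ (2 * r : ℝ) :=
      Real.rpow_pos_of_pos (Finset.prod_pos fun i _ => by
        exact_mod_cast lt_of_lt_of_le two_pos (ht2 i)) _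
    have h3 := h2.trans_le h
    simpa using h3
  have hlow : (r : ℝ≥0∞) ≤ dimH (g '' Ico 0 1) := by
    refine le_dimH_image_Ico (C := C * 2 ^ (r : ℝ)) hr fun x hx y hy hxy => ?_
    have hne : ∃ n, radixDigit c x n ≠ radixDigit c y n := by
      by_contra! hall
      have hlim : Tendsto (fun n : ℕ => ((2 : ℝ) ^ (2 * r : ℝ)) ^ n) atTop atTop :=
        tendsto_pow_atTop_atTop_of_one_lt
          (Real.one_lt_rpow one_lt_two (by positivity))
      have hxy' : 0 < |x - y| := abs_pos.2 (sub_ne_zero.2 hxy)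
      obtain ⟨n, hn⟩ := (hlim.eventually_gt_atTop (C / |x - y|)).exists
      have h1 := abs_sub_mul_le_of_radixDigit_eq (c := c) hx hy n fun i _ => hall i
      have h2 : ((2 : ℝ) ^ (2 * r : ℝ)) ^ n ≤
          (∏ i ∈ Finset.range (n + 1), (t (i + 1) : ℝ)) ^ (2 * r : ℝ) := by
        rw [← Real.rpow_natCast, ← Real.rpow_mul zero_le_two, mul_comm,
          Real.rpow_mul zero_le_two, Real.rpow_natCast]
        refine Real.rpow_le_rpow (by positivity) ?_ (by positivity)
        calc (2 : ℝ) ^ n ≤ 2 ^ (n + 1) := pow_le_pow_right₀ one_le_two n.le_succ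
          _ = ∏ i ∈ Finset.range (n + 1), (2 : ℝ) := by simp
          _ ≤ _ := Finset.prod_le_prod (fun _ _ => zero_le_two) fun i _ => by
            exact_mod_cast ht2 i
      have h3 := hn.trans_le (h2.trans (H n))
      rw [div_lt_iff₀ hxy'] at h3
      have hC0' : (0 : ℝ) < C := hC0
      nlinarith
    classical
    let n := Nat.find hne
    have hn : radixDigit c x n ≠ radixDigit c y n := Nat.find_spec hne
    have hlt (i : ℕ) (hi : i < n) : radixDigit c x i = radixDigit c y i :=
      not_not.1 (Nat.find_min hne hi)
    have h1 := abs_sub_mul_le_of_radixDigit_eq (c := c) hx hy n hlt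
    have h2 := one_le_abs_sub_mul (u := fun n => gaussMap^[n] (g x))
      (v := fun n => gaussMap^[n] (g y)) (hg x hx) (hg y hy) ht2 (hdig x hx) (hdig y hy) n
      (fun i hi => by rw [hlt i hi]) (by omega)
    simp only [Function.iterate_zero, id] at h2
    set Q := ∏ i ∈ Finset.range (n + 1), (t (i + 1) : ℝ) with hQ
    have hQ0 : 0 ≤ Q := Finset.prod_nonneg fun i _ => Nat.cast_nonneg _
    have h3 : 1 ≤ |g x - g y| ^ (r : ℝ) * (2 ^ (r : ℝ) * Q ^ (2 * r : ℝ)) := by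
      have h := Real.one_le_rpow h2 r.coe_nonneg
      rw [Real.mul_rpow (abs_nonneg _) (by positivity),
        Real.mul_rpow zero_le_two (by positivity), ← Real.rpow_natCast, ← Real.rpow_mul hQ0] at h
      exact_mod_cast h
    have hH := H n
    set D : ℝ := ((∏ i ∈ Finset.range n, c i : ℕ) : ℝ) with hD
    have hDpos : 0 < D := by
      rw [hD]; exact_mod_cast Finset.prod_pos fun i _ => hcpos i
    have h4 : |x - y| ≤ 1 / D := by rwa [le_div_iff₀ hDpos]
    refine h4.trans ?_
    rw [div_le_iff₀ hDpos]
    push_cast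
    calc (1 : ℝ) ≤ _ := h3
      _ ≤ |g x - g y| ^ (r : ℝ) * (2 ^ (r : ℝ) * (C * D)) := by gcongr
      _ = _ := by ring
  have hsub : g '' Ico 0 1 ⊆ blockSet t ∪ range ((↑) : ℚ → ℝ) := by
    rintro _ ⟨θ, hθ, rfl⟩
    by_cases hirr : g θ ∈ range ((↑) : ℚ → ℝ)
    · exact Or.inr hirr
    have hpq := pq_succ_eq (hg θ hθ)
    have hmem (i : ℕ) : t i ≤ pq (g θ) (i + 1) ∧ pq (g θ) (i + 1) < t (i + 1) := by
      rw [hpq i]; exact hdig θ hθ i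
    refine Or.inl ⟨⟨(hg θ hθ 0).1, hirr, fun n hn => ?_⟩, hmem⟩
    obtain ⟨m, rfl⟩ := Nat.exists_eq_add_of_le' hn
    exact (hmem m).2.trans_le (hmem (m + 1)).1
  have h := hlow.trans (dimH_mono hsub)
  rwa [dimH_union, dimH_countable (countable_range _), max_eq_left zero_le] at h

open Classical in
/-- Given starting points `B` of blocks, where the block starting at `n ∈ B` is `[n, n + ν n]`,
`blockStart B ν j` is the starting point of the block containing `j`, and `j` itself when `j` lies
in no block. -/
noncomputable def blockStart (B : Set ℕ) (ν : ℕ → ℕ) : ℕ → ℕ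
  | 0 => 0
  | j + 1 => if blockStart B ν j ∈ B ∧ j + 1 ≤ blockStart B ν j + ν (blockStart B ν j)
      then blockStart B ν j else j + 1

lemma blockStart_le (B : Set ℕ) (ν : ℕ → ℕ) (j : ℕ) : blockStart B ν j ≤ j := by
  induction j with
  | zero => simp [blockStart]
  | succ j ih =>
    rw [blockStart]
    split_ifs <;> omega

lemma blockStart_succ_cases (B : Set ℕ) (ν : ℕ → ℕ) (j : ℕ) :
    blockStart B ν (j + 1) = j + 1 ∨
      (blockStart B ν (j + 1) = blockStart B ν j ∧ blockStart B ν j ∈ B ∧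
        j + 1 ≤ blockStart B ν j + ν (blockStart B ν j)) := by
  rw [blockStart]
  split_ifs with h
  · exact Or.inr ⟨rfl, h⟩
  · exact Or.inl rfl

lemma blockStart_add {B : Set ℕ} {ν : ℕ → ℕ}
    (hB : ∀ b ∈ B, ∀ b' ∈ B, b < b' → b + ν b < b') {n : ℕ} (hn : n ∈ B) {i : ℕ} (hi : i ≤ ν n) :
    blockStart B ν (n + i) = n := by
  induction i with
  | zero =>
    rcases n with _ | j
    · simp [blockStart]
    · rcases blockStart_succ_cases B ν j with h | ⟨-, h1, h2⟩
      · exact h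
      · have h3 := blockStart_le B ν j
        have h4 := hB _ h1 _ hn (by omega)
        omega
  | succ i ih =>
    rw [← add_assoc, blockStart, ih (by omega), if_pos ⟨hn, by omega⟩]

/-- The left ends of the digit windows: `j ^ L` off the blocks, and the progression of common
difference `1` issued from `n ^ L` on the block starting at `n`. -/
noncomputable def digitFloor (B : Set ℕ) (ν : ℕ → ℕ) (L j : ℕ) : ℕ :=
  blockStart B ν j ^ L + (j - blockStart B ν j)

lemma pow_add_sub_le_pow {x j L : ℕ} (h : x ≤ j) (hL : L ≠ 0) : x ^ L + (j - x) ≤ j ^ L := by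
  obtain ⟨d, rfl⟩ := Nat.exists_eq_add_of_le h
  rw [Nat.add_sub_cancel_left]
  exact (Nat.add_le_add_left (Nat.le_self_pow hL d) _).trans
    (pow_add_pow_le (Nat.zero_le x) (Nat.zero_le d) hL)

lemma digitFloor_le_pow (B : Set ℕ) (ν : ℕ → ℕ) {L : ℕ} (hL : L ≠ 0) (j : ℕ) :
    digitFloor B ν L j ≤ j ^ L :=
  pow_add_sub_le_pow (blockStart_le B ν j) hL

lemma digitFloor_add_pow_le {B : Set ℕ} {ν : ℕ → ℕ} (K : ℕ) {j : ℕ}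
    (h : blockStart B ν (j + 1) = j + 1) :
    digitFloor B ν (K + 1) j + j ^ K ≤ digitFloor B ν (K + 1) (j + 1) := by
  have h1 := digitFloor_le_pow B ν K.succ_ne_zero j
  have h2 : digitFloor B ν (K + 1) (j + 1) = (j + 1) ^ (K + 1) := by simp [digitFloor, h]
  have h3 : j ^ K ≤ (j + 1) ^ K := Nat.pow_le_pow_left j.le_succ K
  rw [h2, pow_succ]
  rw [Nat.succ_eq_add_one, pow_succ] at h1
  nlinarith [Nat.mul_le_mul_right (j + 1) h3]

lemma digitFloor_strictMono (B : Set ℕ) (ν : ℕ → ℕ) {L : ℕ} (hL : L ≠ 0) :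
    StrictMono (digitFloor B ν L) := by
  refine strictMono_nat_of_lt_succ fun j => ?_
  rcases blockStart_succ_cases B ν j with h | ⟨h, -, -⟩
  · have h1 := digitFloor_le_pow B ν hL j
    have h2 : digitFloor B ν L (j + 1) = (j + 1) ^ L := by simp [digitFloor, h]
    rw [h2]
    exact h1.trans_lt (Nat.pow_lt_pow_left j.lt_succ_self hL)
  · have := blockStart_le B ν j
    rw [digitFloor, digitFloor, h]
    omega

open Classical in
/-- The indices `i < n` such that the digit at `i + 1` is the last one of its block. -/
noncomputable def freeIndices (B : Set ℕ) (ν : ℕ → ℕ) (n : ℕ) : Finset ℕ :=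
  (Finset.range n).filter fun i => blockStart B ν (i + 2) = i + 2

lemma factorial_card_pow_le_prod (B : Set ℕ) (ν : ℕ → ℕ) (K n : ℕ) :
    (freeIndices B ν n).card.factorial ^ K ≤
      ∏ i ∈ Finset.range n, (digitFloor B ν (K + 1) (i + 2) - digitFloor B ν (K + 1) (i + 1)) := by
  induction n with
  | zero => simp [freeIndices]
  | succ n ih =>
    have hmono := digitFloor_strictMono B ν K.succ_ne_zero (Nat.lt_succ_self (n + 1))
    rw [Finset.prod_range_succ]
    by_cases h : blockStart B ν (n + 2) = n + 2
    · have hcard : (freeIndices B ν (n + 1)).card = (freeIndices B ν n).card + 1 := by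
        rw [freeIndices, Finset.range_add_one, Finset.filter_insert, if_pos h,
          Finset.card_insert_of_notMem (by simp)]
        rfl
      have hle : (freeIndices B ν n).card ≤ n := by
        exact (Finset.card_filter_le _ _).trans_eq (Finset.card_range n)
      rw [hcard, Nat.factorial_succ, mul_pow, mul_comm]
      refine Nat.mul_le_mul ih ((Nat.pow_le_pow_left (Nat.succ_le_succ hle) K).trans ?_)
      exact Nat.le_sub_of_add_le' (digitFloor_add_pow_le K h)
    · have heq : freeIndices B ν (n + 1) = freeIndices B ν n := by
        rw [freeIndices, Finset.range_add_one, Finset.filter_insert, if_neg h]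
        rfl
      rw [heq]
      exact ih.trans (Nat.le_mul_of_pos_right _ (Nat.sub_pos_of_lt hmono))

lemma le_card_freeIndices {B : Set ℕ} {ν : ℕ → ℕ} {κ : ℕ} (hκ : 0 < κ) {A : ℝ} (hA : 0 < A)
    (hsparse : ∀ b ∈ B, ∀ b' ∈ B, b < b' → κ * (b + ν b) ≤ b')
    (hν : ∀ b ∈ B, (ν b : ℝ) ≤ A * b) (n : ℕ) :
    (1 / (1 + A) - 1 / κ) * n - 1 ≤ (freeIndices B ν n).card := by
  classical
  set N := (Finset.range n).filter fun i => ¬ blockStart B ν (i + 2) = i + 2 with hN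
  have hsum : (freeIndices B ν n).card + N.card = n := by
    rw [freeIndices, hN, Finset.card_filter_add_card_filter_not, Finset.card_range]
  have hmem (i : ℕ) (hi : i ∈ N) : i < n ∧ ∃ b ∈ B, b ≤ i + 1 ∧ i + 2 ≤ b + ν b := by
    rw [hN, Finset.mem_filter, Finset.mem_range] at hi
    rcases blockStart_succ_cases B ν (i + 1) with h | ⟨-, h1, h2⟩
    · exact absurd h hi.2
    · exact ⟨hi.1, _, h1, blockStart_le B ν (i + 1), h2⟩
  have hsumR : ((freeIndices B ν n).card : ℝ) + N.card = n := by exact_mod_cast hsum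
  have hA1 : 0 < 1 + A := by linarith
  have hκR : (0 : ℝ) < κ := by exact_mod_cast hκ
  have hn0 : (0 : ℝ) ≤ n := Nat.cast_nonneg n
  suffices hcard : (N.card : ℝ) ≤ n / κ + A * (n + 1) / (1 + A) by
    have h1 : A * ((n : ℝ) + 1) / (1 + A) ≤ n - n / (1 + A) + 1 := by
      rw [div_le_iff₀ hA1]
      field_simp
      nlinarith
    have h2 : (1 / (1 + A) - 1 / κ) * (n : ℝ) = n / (1 + A) - n / κ := by ring
    linarith
  by_cases hex : ∃ b, b ≤ n ∧ b ∈ B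
  · obtain ⟨b₀, hb₀n, hb₀⟩ := hex
    set b := Nat.findGreatest (· ∈ B) n with hb
    have hbB : b ∈ B := Nat.findGreatest_spec (P := (· ∈ B)) hb₀n hb₀
    have hbn : b ≤ n := Nat.findGreatest_le n
    have hsub : N ⊆ Finset.range (b / κ) ∪ Finset.Ico (b - 1) (min n (b + ν b - 1)) := by
      intro i hi
      obtain ⟨hin, b', hb'B, hb'i, hib'⟩ := hmem i hi
      have hb'b : b' ≤ b := Nat.le_findGreatest (by omega) hb'B
      rw [Finset.mem_union, Finset.mem_range, Finset.mem_Ico]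
      rcases hb'b.lt_or_eq with h | rfl
      · left
        have h1 := hsparse b' hb'B b hbB h
        rw [Nat.lt_iff_add_one_le, Nat.le_div_iff_mul_le hκ]
        nlinarith
      · right
        omega
    have hc := (Finset.card_le_card hsub).trans (Finset.card_union_le _ _)
    rw [Finset.card_range, Nat.card_Ico] at hc
    have hbκ : ((b / κ : ℕ) : ℝ) ≤ n / κ :=
      Nat.cast_div_le.trans (by gcongr)
    obtain ⟨M, hM⟩ : ∃ M, M = min n (b + ν b - 1) - (b - 1) := ⟨_, rfl⟩
    rw [← hM] at hc
    have hM1 : (M : ℝ) ≤ A * b := le_trans (by exact_mod_cast (by omega : M ≤ ν b)) (hν b hbB)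
    have hM2 : (M : ℝ) + b ≤ n + 1 := by exact_mod_cast (by omega : M + b ≤ n + 1)
    have hM3 : (M : ℝ) ≤ A * (n + 1) / (1 + A) := by
      rw [le_div_iff₀ hA1]
      nlinarith
    have hcR : (N.card : ℝ) ≤ ((b / κ : ℕ) : ℝ) + M := by exact_mod_cast hc
    linarith
  · have : N = ∅ := by
      refine Finset.eq_empty_of_forall_notMem fun i hi => hex ?_
      obtain ⟨hin, b', hb'B, hb'i, -⟩ := hmem i hi
      exact ⟨b', by omega, hb'B⟩
    rw [this, Finset.card_empty, Nat.cast_zero]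
    positivity

lemma blockSet_subset_Fset {B : Set ℕ} {ν : ℕ → ℕ} (L : ℕ) (hB0 : 0 ∉ B)
    (hB : ∀ b ∈ B, ∀ b' ∈ B, b < b' → b + ν b < b') (hinf : ∀ N, ∃ b ∈ B, N ≤ b) :
    blockSet (fun i => digitFloor B ν L (i + 1)) ⊆ Fset ν := by
  rintro x ⟨hxJ, hx⟩
  refine ⟨hxJ, fun N => ?_⟩
  obtain ⟨n, hnB, hNn⟩ := hinf N
  have hn0 : n ≠ 0 := fun h => hB0 (h ▸ hnB)
  obtain ⟨k, rfl⟩ := Nat.exists_eq_succ_of_ne_zero hn0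
  have hdig (i : ℕ) (hi : i ≤ ν (k + 1)) :
      digitFloor B ν L (k + 1 + i) = (k + 1) ^ L + i := by
    rw [digitFloor, blockStart_add hB hnB hi, Nat.add_sub_cancel_left]
  have hpq (i : ℕ) (hi : i + 1 ≤ ν (k + 1)) : pq x (k + 1 + i) = (k + 1) ^ L + i := by
    have h1 : digitFloor B ν L (k + i + 1) ≤ pq x (k + i + 1) ∧
        pq x (k + i + 1) < digitFloor B ν L (k + i + 1 + 1) := hx (k + i)
    have h2 := hdig i (by omega)
    have h3 := hdig (i + 1) hi
    rw [show k + i + 1 = k + 1 + i by ring] at h1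
    rw [← add_assoc] at h3
    simp only [h2, h3] at h1
    omega
  refine ⟨k + 1, hNn, k.succ_pos, 1, fun i hi => ?_⟩
  have h1 := hpq i (by omega)
  have h2 := hpq (i + 1) (by omega)
  rw [← add_assoc] at h2
  rw [h1, h2]
  push_cast
  ring

lemma exists_sparse_strictMono {P : ℕ → Prop} (hP : ∀ N, ∃ n ≥ N, P n) (h : ℕ → ℕ) :
    ∃ b : ℕ → ℕ, StrictMono b ∧ 0 < b 0 ∧ (∀ k, P (b k)) ∧ ∀ k l, k < l → h (b k) < b l := by
  choose g hg hgP using hP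
  let b : ℕ → ℕ := fun k => Nat.rec (g 1) (fun _ m => g (m + h m + 1)) k
  have hb (k : ℕ) : b k + h (b k) + 1 ≤ b (k + 1) := hg _
  have hmono : StrictMono b := strictMono_nat_of_lt_succ fun k => by have := hb k; omega
  refine ⟨b, hmono, hg 1, fun k => ?_, fun k l hkl => ?_⟩
  · cases k with
    | zero => exact hgP _
    | succ k => exact hgP _
  · have h1 := hb k
    have h2 := hmono.monotone (Nat.succ_le_of_lt hkl)
    simp only [Nat.succ_eq_add_one] at h2
    omega

/-- Comparison of powers of factorials when the arguments are asymptotically proportional. -/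
lemma eventually_factorial_pow_le {p q β : ℝ} (hp : 0 ≤ p) (hq : 0 < q)
    (hpq : p < q * β) {F : ℕ → ℕ} (hF : ∀ n : ℕ, β * n - 1 ≤ F n) :
    ∀ᶠ n : ℕ in atTop, ((n + 2).factorial : ℝ) ^ p ≤ ((F n).factorial : ℝ) ^ q := by
  obtain ⟨β', hβ'1, hβ'2⟩ := exists_between ((div_lt_iff₀' hq).2 hpq)
  have hβ'0 : 0 < β' := (div_nonneg hp hq.le).trans_lt hβ'1
  rw [div_lt_iff₀' hq] at hβ'1
  have hcast : Tendsto (fun n : ℕ => (n : ℝ)) atTop atTop := tendsto_natCast_atTop_atTop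
  have hlog : Tendsto (fun n : ℕ => Real.log ((n : ℝ) + 2)) atTop atTop :=
    Real.tendsto_log_atTop.comp (tendsto_atTop_add_const_right _ _ hcast)
  filter_upwards [hcast.eventually_ge_atTop ((2 * β' + 1) / (β - β')),
    hlog.eventually_ge_atTop (q * β' * (1 - Real.log β') / (q * β' - p)),
    hlog.eventually_ge_atTop (1 - Real.log β')] with n hn1 hn2 hn3
  rw [div_le_iff₀ (by linarith)] at hn1 hn2
  set z : ℝ := (n : ℝ) + 2 with hz
  have hz0 : 0 < z := by positivity
  have hFz : β' * z ≤ F n := by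
    refine le_trans ?_ (hF n)
    rw [hz]; linarith
  have hF0 : 0 < (F n : ℝ) := (mul_pos hβ'0 hz0).trans_le hFz
  have hlogF : Real.log z + Real.log β' ≤ Real.log (F n) := by
    rw [add_comm, ← Real.log_mul hβ'0.ne' hz0.ne']
    exact Real.log_le_log (mul_pos hβ'0 hz0) hFz
  have hup : Real.log ((n + 2).factorial : ℝ) ≤ z * Real.log z := by
    rw [hz, ← Nat.cast_ofNat (R := ℝ) (n := 2), ← Nat.cast_add, ← Real.log_pow]
    refine Real.log_le_log (by positivity) ?_
    exact_mod_cast Nat.factorial_le_pow (n + 2)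
  have hlow : (F n : ℝ) * (Real.log (F n) - 1) ≤ Real.log ((F n).factorial : ℝ) := by
    have h2 : (F n : ℝ) ^ (F n) / (F n).factorial ≤ Real.exp (F n) :=
      Real.pow_div_factorial_le_exp (F n : ℝ) hF0.le (F n)
    have h3 := Real.log_le_log (by positivity) h2
    rw [Real.log_exp, Real.log_div (by positivity) (by positivity), Real.log_pow] at h3
    linarith
  rw [← Real.log_le_log_iff (by positivity) (by positivity), Real.log_rpow (by positivity),
    Real.log_rpow (by positivity)]
  calc p * Real.log ((n + 2).factorial : ℝ) ≤ p * (z * Real.log z) := by gcongr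
    _ ≤ q * (β' * z * (Real.log z + Real.log β' - 1)) := by nlinarith
    _ ≤ q * (F n * (Real.log (F n) - 1)) := by
      have : 0 ≤ Real.log z + Real.log β' - 1 := by linarith
      gcongr
    _ ≤ q * Real.log ((F n).factorial : ℝ) := by gcongr

lemma exists_forall_le_mul_of_eventually_le {u w : ℕ → ℝ} (hu : ∀ n, 0 ≤ u n) (hw : ∀ n, 1 ≤ w n)
    (h : ∀ᶠ n in atTop, u n ≤ w n) : ∃ C : ℝ≥0, ∀ n, u n ≤ C * w n := by
  obtain ⟨N, hN⟩ := eventually_atTop.1 h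
  have hS : 0 ≤ ∑ i ∈ Finset.range N, u i := Finset.sum_nonneg fun i _ => hu i
  refine ⟨(1 + ∑ i ∈ Finset.range N, u i).toNNReal, fun n => ?_⟩
  rw [Real.coe_toNNReal _ (by positivity)]
  have hw' := hw n
  rcases lt_or_ge n N with hn | hn
  · have := Finset.single_le_sum (fun i _ => hu i) (Finset.mem_range.2 hn)
    nlinarith
  · have := hN n hn
    nlinarith

lemma le_dimH_Fset {ν : ℕ → ℕ} {A : ℝ} (hA : 0 < A)
    (hν : ∀ N, ∃ n ≥ N, (ν n : ℝ) ≤ A * n) {r : ℝ≥0} (hr : 0 < r) (hrA : 2 * (r : ℝ) * (1 + A) < 1) :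
    (r : ℝ≥0∞) ≤ dimH (Fset ν) := by
  have hA1 : 0 < 1 + A := by linarith
  have hr' : (0 : ℝ) < r := hr
  have hgap : 0 < 1 / (1 + A) - 2 * r := by
    rw [sub_pos, lt_div_iff₀ hA1]; exact hrA
  obtain ⟨m, hm⟩ := exists_nat_one_div_lt hgap
  set κ := m + 1 with hκ
  set β : ℝ := 1 / (1 + A) - 1 / κ with hβ
  have hrβ : 2 * (r : ℝ) < β := by
    rw [hβ, hκ]; push_cast; linarith
  obtain ⟨K, hK⟩ := exists_nat_gt (2 * (r : ℝ) / (β - 2 * r))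
  rw [div_lt_iff₀ (by linarith)] at hK
  have hK0 : 0 < K := by
    rcases K.eq_zero_or_pos with rfl | h
    · norm_num at hK; linarith
    · exact h
  obtain ⟨b, hbmono, hb0, hbν, hbs⟩ := exists_sparse_strictMono hν fun n => κ * (n + ν n)
  set B := range b with hB
  have hB0 : 0 ∉ B := by
    rintro ⟨k, hk⟩
    have := hbmono.monotone k.zero_le
    omega
  have hsparse : ∀ n ∈ B, ∀ n' ∈ B, n < n' → κ * (n + ν n) < n' := by
    rintro _ ⟨k, rfl⟩ _ ⟨l, rfl⟩ hkl
    exact hbs k l (hbmono.lt_iff_lt.1 hkl)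
  have hsep : ∀ n ∈ B, ∀ n' ∈ B, n < n' → n + ν n < n' := fun n hn n' hn' h =>
    (Nat.le_mul_of_pos_left _ m.succ_pos).trans_lt (hsparse n hn n' hn' h)
  have hinf (N : ℕ) : ∃ n ∈ B, N ≤ n := ⟨b N, ⟨N, rfl⟩, hbmono.id_le N⟩
  refine le_trans ?_ (dimH_mono (blockSet_subset_Fset (K + 1) hB0 hsep hinf))
  have hs := digitFloor_strictMono B ν K.succ_ne_zero
  have hone : 1 ≤ digitFloor B ν (K + 1) (0 + 1) := hs.id_le 1
  have hev := eventually_factorial_pow_le (p := 2 * r * (K + 1)) (q := K) (β := β)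
    (F := fun n => (freeIndices B ν n).card) (by positivity) (by exact_mod_cast hK0)
    (by linarith)
    (le_card_freeIndices m.succ_pos hA (fun n hn n' hn' h => (hsparse n hn n' hn' h).le)
      (by rintro _ ⟨k, rfl⟩; exact hbν k))
  obtain ⟨C, hC⟩ := exists_forall_le_mul_of_eventually_le (fun n => by positivity)
    (fun n => Real.one_le_rpow (by exact_mod_cast Nat.one_le_iff_ne_zero.2 (Nat.factorial_ne_zero _))
      (by positivity)) hev
  refine le_dimH_blockSet (C := C) (fun i j hij => hs (Nat.succ_lt_succ hij)) hone hr fun n => ?_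
  have hprod : ∏ i ∈ Finset.range (n + 1), (digitFloor B ν (K + 1) (i + 1 + 1) : ℝ) ≤
      ((n + 2).factorial : ℝ) ^ (K + 1) := by
    have h1 : ∏ i ∈ Finset.range (n + 1), (i + 2) = (n + 2).factorial := by
      induction n with
      | zero => simp
      | succ n ih => rw [Finset.prod_range_succ, ih, Nat.factorial_succ (n + 2), mul_comm]
    rw [← h1]
    push_cast
    rw [← Finset.prod_pow]
    refine Finset.prod_le_prod (fun i _ => Nat.cast_nonneg _) fun i _ => ?_
    exact_mod_cast digitFloor_le_pow B ν K.succ_ne_zero (i + 1 + 1)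
  calc _ ≤ (((n + 2).factorial : ℝ) ^ (K + 1)) ^ (2 * r : ℝ) := by
        refine Real.rpow_le_rpow ?_ hprod (by positivity)
        exact Finset.prod_nonneg fun i _ => Nat.cast_nonneg _
    _ = ((n + 2).factorial : ℝ) ^ (2 * r * (K + 1) : ℝ) := by
        rw [← Real.rpow_natCast, ← Real.rpow_mul (Nat.cast_nonneg _)]
        push_cast
        ring_nf
    _ ≤ C * ((freeIndices B ν n).card.factorial : ℝ) ^ (K : ℝ) := hC n
    _ ≤ _ := by
        rw [Real.rpow_natCast]
        gcongr
        exact_mod_cast factorial_card_pow_le_prod B ν K n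

/-- Proposition 4.1 (lower bound): `dim_H F((ν_n)) ≥ 1/(2(1+α))` where
`α = liminf ν_n / n < ∞`. -/
theorem stmt6 (ν : ℕ → ℕ) (hν1 : ∀ n, 1 ≤ ν n) (hmono : Monotone ν)
    (α : ℝ≥0∞) (hα : α = Filter.liminf (fun n : ℕ => (ν n : ℝ≥0∞) / (n : ℝ≥0∞)) Filter.atTop)
    (hfin : α ≠ ⊤) :
    1 / (2 * (1 + α)) ≤ dimH (Fset ν) := by
  refine ENNReal.le_of_forall_nnreal_lt fun r hr => ?_
  rcases eq_or_ne r 0 with rfl | hr0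
  · simp
  lift α to ℝ≥0 using hfin
  have hrα : r * (2 * (1 + α)) < 1 := by
    have h := (ENNReal.lt_div_iff_mul_lt (Or.inl (by simp)) (Or.inl (by finiteness))).1 hr
    exact_mod_cast h
  have hr' : (0 : ℝ) < r := by positivity
  have hrα' : (r : ℝ) * (2 * (1 + α)) < 1 := by exact_mod_cast hrα
  obtain ⟨A, hαA, hA⟩ : ∃ A : ℝ, (α : ℝ) < A ∧ A < 1 / (2 * r) - 1 := by
    refine exists_between ?_
    rw [lt_sub_iff_add_lt, lt_div_iff₀ (by positivity)]
    linarith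
  have hA0 : 0 < A := α.coe_nonneg.trans_lt hαA
  refine le_dimH_Fset hA0 (fun N => ?_) (pos_iff_ne_zero.2 hr0) ?_
  · have hlt : Filter.liminf (fun n : ℕ => (ν n : ℝ≥0∞) / (n : ℝ≥0∞)) atTop < ENNReal.ofReal A := by
      rw [← hα, ← ENNReal.ofReal_coe_nnreal]
      exact (ENNReal.ofReal_lt_ofReal_iff hA0).2 hαA
    obtain ⟨n, hn, hnA⟩ := frequently_atTop.1 (frequently_lt_of_liminf_lt (by isBoundedDefault) hlt)
      (N + 1)
    refine ⟨n, by omega, ?_⟩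
    have hn0 : (n : ℝ≥0∞) ≠ 0 := by
      have : n ≠ 0 := by omega
      exact_mod_cast this
    have h := (ENNReal.div_le_iff hn0 (ENNReal.natCast_ne_top n)).1 hnA.le
    rw [← ENNReal.ofReal_natCast, ← ENNReal.ofReal_natCast, ← ENNReal.ofReal_mul hA0.le] at h
    exact (ENNReal.ofReal_le_ofReal_iff (by positivity)).1 h
  · rw [lt_sub_iff_add_lt, lt_div_iff₀ (by positivity)] at hA
    linarith
end

section
/- Let (σ_n)_{n≥1} be a strictly increasing sequence of positive integers with σ_{n+1} − σ_n ≥ n for all n ≥ 1 and such that (σ_{n+1} − σ_n)/n → ∞ as n → ∞. Then the Hausdorff dimension of G((σ_n)) is at least 1/2. -/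
open Filter MeasureTheory Set
open scoped ENNReal NNReal Topology

/-- Every sequence of integers `≥ 2` is realised as the continued fraction digits of a sequence
of complete quotients. -/
theorem exists_tails (a : ℕ → ℕ) (ha : ∀ k, 2 ≤ a k) :
    ∃ x : ℕ → ℝ, (∀ k, x k ∈ Set.Icc (0 : ℝ) 1) ∧ ∀ k, x k = 1 / (a k + x (k + 1)) := by
  have hfin : ∀ n : ℕ, ∀ a : ℕ → ℕ, (∀ k, 2 ≤ a k) →
      ∃ x : ℕ → ℝ, (∀ k, x k ∈ Set.Icc (0 : ℝ) 1) ∧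
        ∀ k < n, x k * (a k + x (k + 1)) = 1 := by
    intro n
    induction n with
    | zero => exact fun a _ => ⟨fun _ => 0, by simp, by simp⟩
    | succ n ih =>
      intro a ha
      obtain ⟨x, hx, hxe⟩ := ih (fun k => a (k + 1)) (fun k => ha _)
      have h2 : (2 : ℝ) ≤ a 0 := by exact_mod_cast ha 0
      have h0 := (hx 0).1
      refine ⟨fun k => Nat.casesOn k (1 / (a 0 + x 0)) x, ?_, ?_⟩
      · rintro (_ | k)
        · refine ⟨one_div_nonneg.2 (by linarith), ?_⟩
          change 1 / (a 0 + x 0) ≤ 1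
          rw [div_le_one (by linarith)]
          linarith
        · exact hx k
      · rintro (_ | k) hk
        · change 1 / (a 0 + x 0) * (a 0 + x 0) = 1
          exact one_div_mul_cancel (by linarith)
        · exact hxe k (by omega)
  let C : ℕ → Set (ℕ → ℝ) := fun n =>
    (Set.univ.pi fun _ => Set.Icc (0 : ℝ) 1) ∩ ⋂ k ∈ Set.Iio n, {x | x k * (a k + x (k + 1)) = 1}
  have hcl : ∀ n, IsClosed (⋂ k ∈ Set.Iio n, {x : ℕ → ℝ | x k * (a k + x (k + 1)) = 1}) := fun n =>
    isClosed_biInter fun k _ => isClosed_eq (by fun_prop) (by fun_prop)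
  have hcomp : ∀ n, IsCompact (C n) := fun n =>
    (isCompact_univ_pi fun _ => isCompact_Icc).inter_right (hcl n)
  obtain ⟨x, hx⟩ := IsCompact.nonempty_iInter_of_sequence_nonempty_isCompact_isClosed C
    (fun n => Set.inter_subset_inter_right _
      (Set.biInter_mono (fun k (hk : k < n) => Nat.lt_succ_of_lt hk) fun _ _ => subset_rfl))
    (fun n => by
      obtain ⟨x, hx, hxe⟩ := hfin n a ha
      exact ⟨x, fun k _ => hx k, by simpa using hxe⟩)
    (hcomp 0) (fun n => (hcomp n).isClosed)
  rw [Set.mem_iInter] at hx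
  have hI : ∀ k, x k ∈ Set.Icc (0 : ℝ) 1 := fun k => (hx 0).1 k trivial
  refine ⟨x, hI, fun k => ?_⟩
  have h := (hx (k + 1)).2
  simp only [Set.mem_iInter] at h
  exact eq_one_div_of_mul_eq_one_left (h k (Nat.lt_succ_self k))

/-- The recursion satisfied by the tails `x k = [0; a k, a (k + 1), …]` of a continued fraction. -/
structure IsTails (a : ℕ → ℕ) (x : ℕ → ℝ) : Prop where
  two_le : ∀ k, 2 ≤ a k
  mem : ∀ k, x k ∈ Set.Icc (0 : ℝ) 1
  eq : ∀ k, x k = 1 / (a k + x (k + 1))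

namespace IsTails

variable {a a' : ℕ → ℕ} {x x' : ℕ → ℝ}

theorem den_ge (h : IsTails a x) (k : ℕ) : 2 ≤ a k + x (k + 1) := by
  have h2 : (2 : ℝ) ≤ a k := by exact_mod_cast h.two_le k
  linarith [(h.mem (k + 1)).1]

theorem pos (h : IsTails a x) (k : ℕ) : 0 < x k := by
  rw [h.eq k]
  have := h.den_ge k
  positivity

theorem le_half (h : IsTails a x) (k : ℕ) : x k ≤ 1 / 2 := by
  rw [h.eq k]
  exact one_div_le_one_div_of_le (by norm_num) (h.den_ge k)

theorem one_div_eq (h : IsTails a x) (k : ℕ) : 1 / x k = a k + x (k + 1) := by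
  rw [h.eq k, one_div_one_div]

theorem floor_eq (h : IsTails a x) (k : ℕ) : ⌊1 / x k⌋ = a k := by
  rw [h.one_div_eq k, Int.floor_eq_iff]
  have h1 := h.pos (k + 1)
  have h2 := h.le_half (k + 1)
  push_cast
  constructor <;> linarith

theorem gaussMap_eq (h : IsTails a x) (k : ℕ) : gaussMap (x k) = x (k + 1) := by
  rw [gaussMap, h.floor_eq k, h.one_div_eq k]
  push_cast
  ring

theorem iterate_gaussMap (h : IsTails a x) (k : ℕ) : gaussMap^[k] (x 0) = x k := by
  induction k with
  | zero => rfl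
  | succ k ih => rw [Function.iterate_succ_apply', ih, h.gaussMap_eq]

theorem pq_succ (h : IsTails a x) (k : ℕ) : pq (x 0) (k + 1) = a k := by
  rw [pq, Nat.add_sub_cancel, h.iterate_gaussMap, h.floor_eq, Int.toNat_natCast]

theorem ne_div (h : IsTails a x) (q : ℕ) : ∀ (k : ℕ) (p : ℤ), x k ≠ p / q := by
  induction q using Nat.strong_induction_on with
  | _ q ih =>
    intro k p hp
    have hpos := h.pos k
    have hhalf := h.le_half k
    have hq : (0 : ℝ) < q := by
      rcases Nat.eq_zero_or_pos q with rfl | hq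
      · simp [hp] at hpos
      · exact_mod_cast hq
    have hp0 : (0 : ℝ) < p := by
      rw [hp] at hpos
      exact (div_pos_iff_of_pos_right hq).1 hpos
    have hpq : (p : ℝ) < q := by
      rw [hp, div_le_iff₀ hq] at hhalf
      linarith
    lift p to ℕ using (by exact_mod_cast hp0.le)
    have hpq' : p < q := by exact_mod_cast hpq
    refine ih p hpq' (k + 1) ((q : ℤ) - a k * p) ?_
    have h1 := h.one_div_eq k
    rw [hp] at h1
    push_cast at h1 hp0 ⊢
    field_simp at h1 ⊢
    linarith

theorem irrational (h : IsTails a x) (k : ℕ) : Irrational (x k) := by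
  rintro ⟨r, hr⟩
  refine h.ne_div r.den k r.num ?_
  rw [← hr]
  exact Rat.cast_def r

theorem inv_le (h : IsTails a x) {k : ℕ} {B : ℝ} (hB : (a k : ℝ) + 1 ≤ B) : 1 ≤ x k * B := by
  have h1 := h.one_div_eq k
  have h2 := h.le_half (k + 1)
  have h3 := h.pos k
  rw [div_eq_iff h3.ne'] at h1
  nlinarith

/-- Two continued fractions whose digits first differ at the index `n` are separated. -/
theorem separation (h : IsTails a x) (h' : IsTails a' x') {B : ℕ → ℝ}
    (hB : ∀ k, (a k : ℝ) + 1 ≤ B k) (hB' : ∀ k, (a' k : ℝ) + 1 ≤ B k) (n : ℕ) :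
    ∀ j, (∀ i < n, a (j + i) = a' (j + i)) → a (j + n) ≠ a' (j + n) →
      1 ≤ 2 * |x j - x' j| * ∏ i ∈ Finset.range (n + 1), B (j + i) ^ 2 := by
  have key : ∀ k (d : ℝ), 0 ≤ d → d ≤ |1 / x k - 1 / x' k| → d ≤ |x k - x' k| * B k ^ 2 := by
    intro k d hd hle
    have p := h.pos k
    have p' := h'.pos k
    have e : |x k - x' k| = x k * x' k * |1 / x k - 1 / x' k| := by
      rw [abs_sub_comm, ← abs_of_pos (mul_pos p p'), ← abs_mul]
      congr 1
      field_simp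
    have hm : 1 ≤ (x k * B k) * (x' k * B k) :=
      one_le_mul_of_one_le_of_one_le (h.inv_le (hB k)) (h'.inv_le (hB' k))
    rw [e]
    calc d ≤ |1 / x k - 1 / x' k| := hle
      _ ≤ |1 / x k - 1 / x' k| * ((x k * B k) * (x' k * B k)) :=
        le_mul_of_one_le_right (abs_nonneg _) hm
      _ = _ := by ring
  induction n with
  | zero =>
    intro j _ hne
    have := key j (1 / 2) (by norm_num) (by
      rw [h.one_div_eq, h'.one_div_eq]
      have u1 := h.pos (j + 1)
      have u2 := h.le_half (j + 1)
      have v1 := h'.pos (j + 1)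
      have v2 := h'.le_half (j + 1)
      rcases lt_or_gt_of_ne hne with hlt | hlt
      · have : (a j : ℝ) + 1 ≤ a' j := by exact_mod_cast hlt
        rw [le_abs]
        right
        linarith
      · have : (a' j : ℝ) + 1 ≤ a j := by exact_mod_cast hlt
        rw [le_abs]
        left
        linarith)
    simp only [zero_add, Finset.prod_range_one, add_zero]
    linarith
  | succ n ih =>
    intro j heq hne
    have h1 := ih (j + 1) (fun i hi => by
      have := heq (i + 1) (by omega)
      rwa [show j + 1 + i = j + (i + 1) by ring]) (by
      rwa [show j + 1 + n = j + (n + 1) by ring])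
    have h2 := key j |x (j + 1) - x' (j + 1)| (abs_nonneg _) (by
      have := heq 0 (by omega)
      rw [add_zero] at this
      rw [h.one_div_eq, h'.one_div_eq, this, add_sub_add_left_eq_sub])
    rw [Finset.prod_range_succ']
    have e : ∀ i, j + 1 + i = j + (i + 1) := fun i => by ring
    simp only [e, add_zero] at h1 ⊢
    set Q := ∏ i ∈ Finset.range (n + 1), B (j + (i + 1)) ^ 2
    have hQ : 0 ≤ Q := Finset.prod_nonneg fun i _ => sq_nonneg _
    calc 1 ≤ 2 * |x (j + 1) - x' (j + 1)| * Q := h1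
      _ ≤ 2 * (|x j - x' j| * B j ^ 2) * Q := by gcongr
      _ = _ := by ring

end IsTails

/-- An inverse Hölder parametrisation by the unit interval bounds the dimension from below. -/
theorem le_dimH_image_of_inverse_holder {g : ℝ → ℝ} {r C : ℝ≥0} (hr : 0 < r)
    (hg : ∀ y ∈ Set.Ico (0 : ℝ) 1, ∀ z ∈ Set.Ico (0 : ℝ) 1,
      |y - z| ≤ C * |g y - g z| ^ (r : ℝ)) :
    (r : ℝ≥0∞) ≤ dimH (g '' Set.Ico 0 1) := by
  have hinj : Set.InjOn g (Set.Ico 0 1) := by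
    intro y hy z hz hyz
    have := hg y hy z hz
    rw [hyz, sub_self, abs_zero, Real.zero_rpow (by exact_mod_cast hr.ne'), mul_zero] at this
    exact sub_eq_zero.1 (abs_nonpos_iff.1 this)
  have hleft := hinj.leftInvOn_invFunOn
  set f := Function.invFunOn g (Set.Ico 0 1)
  have hf : HolderOnWith C r f (g '' Set.Ico 0 1) := by
    rintro _ ⟨y, hy, rfl⟩ _ ⟨z, hz, rfl⟩
    rw [hleft hy, hleft hz, edist_dist, edist_dist,
      ENNReal.ofReal_rpow_of_nonneg dist_nonneg r.coe_nonneg, Real.dist_eq, Real.dist_eq,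
      ← ENNReal.ofReal_coe_nnreal, ← ENNReal.ofReal_mul C.coe_nonneg]
    exact ENNReal.ofReal_le_ofReal (hg y hy z hz)
  have h1 := hf.dimH_image_le hr
  rw [hleft.image_image, Real.dimH_of_nonempty_interior (by simp [interior_Ico])] at h1
  have hr0 : (r : ℝ≥0∞) ≠ 0 := by exact_mod_cast hr.ne'
  simpa using (ENNReal.le_div_iff_mul_le (Or.inl hr0) (Or.inl ENNReal.coe_ne_top)).1 h1

section Digits

open Classical in
/-- The sum of the indices below `n` that are not prescribed by `P`. -/
noncomputable def freeSum (P : ℕ → Prop) (n : ℕ) : ℕ := ∑ k ∈ Finset.range n with ¬ P k, k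

open Classical in
/-- The digits attached to `y ∈ [0, 1)`: at an index `k` prescribed by `P` the digit is `c k`,
at the other indices it is `2 ^ k` plus a block of `k` binary digits of `y`. -/
noncomputable def digit (P : ℕ → Prop) (c : ℕ → ℕ) (y : ℝ) (k : ℕ) : ℕ :=
  if P k then c k else 2 ^ k + ⌊y * 2 ^ freeSum P (k + 1)⌋₊ % 2 ^ k

variable {P : ℕ → Prop} {c : ℕ → ℕ}

theorem digit_of_pos {k : ℕ} (h : P k) (y : ℝ) : digit P c y k = c k := if_pos h

theorem digit_of_neg {k : ℕ} (h : ¬ P k) (y : ℝ) :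
    digit P c y k = 2 ^ k + ⌊y * 2 ^ freeSum P (k + 1)⌋₊ % 2 ^ k := if_neg h

theorem two_pow_le_digit {k : ℕ} (h : ¬ P k) (y : ℝ) : 2 ^ k ≤ digit P c y k := by
  rw [digit_of_neg h]
  exact Nat.le_add_right _ _

theorem digit_lt (hc : ∀ k, P k → c k < 2 ^ (k + 1)) (y : ℝ) (k : ℕ) :
    digit P c y k < 2 ^ (k + 1) := by
  by_cases h : P k
  · rw [digit_of_pos h]
    exact hc k h
  · rw [digit_of_neg h, pow_succ, mul_two]
    exact Nat.add_lt_add_left (Nat.mod_lt _ (by positivity)) _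

theorem floor_eq_of_digit_eq {y z : ℝ} (hy : y ∈ Set.Ico (0 : ℝ) 1) (hz : z ∈ Set.Ico (0 : ℝ) 1)
    (n : ℕ) (h : ∀ k < n, digit P c y k = digit P c z k) :
    ⌊y * 2 ^ freeSum P n⌋₊ = ⌊z * 2 ^ freeSum P n⌋₊ := by
  classical
  induction n with
  | zero =>
    simp [freeSum, Nat.floor_eq_zero.2 hy.2, Nat.floor_eq_zero.2 hz.2]
  | succ n ih =>
    have ih := ih fun k hk => h k (by omega)
    by_cases hP : P n
    · have e : freeSum P (n + 1) = freeSum P n := by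
        simp [freeSum, Finset.range_add_one, Finset.filter_insert, hP]
      rw [e, ih]
    · have e : freeSum P (n + 1) = freeSum P n + n := by
        simp [freeSum, Finset.range_add_one, Finset.filter_insert, hP, add_comm]
      have hd := h n (by omega)
      rw [digit_of_neg hP, digit_of_neg hP] at hd
      have hmod := Nat.add_left_cancel hd
      have hdiv : ∀ w : ℝ, ⌊w * 2 ^ freeSum P (n + 1)⌋₊ / 2 ^ n = ⌊w * 2 ^ freeSum P n⌋₊ := by
        intro w
        rw [← Nat.floor_div_natCast, e, pow_add]
        congr 1
        push_cast
        field_simp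
      rw [← Nat.div_add_mod ⌊y * 2 ^ freeSum P (n + 1)⌋₊ (2 ^ n), hdiv, hmod, ih, ← hdiv z,
        Nat.div_add_mod]

theorem abs_sub_le_of_digit_eq {y z : ℝ} (hy : y ∈ Set.Ico (0 : ℝ) 1)
    (hz : z ∈ Set.Ico (0 : ℝ) 1) (n : ℕ) (h : ∀ k < n, digit P c y k = digit P c z k) :
    |y - z| * 2 ^ freeSum P n ≤ 1 := by
  have e := floor_eq_of_digit_eq hy hz n h
  set t : ℝ := 2 ^ freeSum P n
  have ht : 0 < t := by positivity
  have h1 := Nat.floor_le (mul_nonneg hy.1 ht.le)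
  have h2 := Nat.lt_floor_add_one (y * t)
  have h3 := Nat.floor_le (mul_nonneg hz.1 ht.le)
  have h4 := Nat.lt_floor_add_one (z * t)
  rw [e] at h1 h2
  rw [← abs_of_pos ht, ← abs_mul, abs_le]
  constructor <;> linarith

theorem exists_digit_ne {y z : ℝ} (hy : y ∈ Set.Ico (0 : ℝ) 1)
    (hz : z ∈ Set.Ico (0 : ℝ) 1) (hyz : y ≠ z) (hK : ∀ m, ∃ n, m ≤ freeSum P n) :
    ∃ n, digit P c y n ≠ digit P c z n := by
  by_contra! hall
  obtain ⟨m, hm⟩ := exists_nat_gt (1 / |y - z|)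
  obtain ⟨n, hn⟩ := hK m
  have hpos : 0 < |y - z| := abs_pos.2 (sub_ne_zero.2 hyz)
  have h1 := abs_sub_le_of_digit_eq hy hz n fun k _ => hall k
  have h2 : (m : ℝ) < 2 ^ m := by exact_mod_cast Nat.lt_two_pow_self
  have h3 : (2 : ℝ) ^ m ≤ 2 ^ freeSum P n := pow_le_pow_right₀ (by norm_num) hn
  rw [div_lt_iff₀ hpos] at hm
  nlinarith

open Classical in
/-- If the prescribed indices have density zero, `freeSum` is almost `n ^ 2 / 2`. -/
theorem freeSum_lower (hD : ∀ M : ℕ, ∃ C : ℕ, ∀ n : ℕ,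
      M * ((Finset.range n).filter P).card ≤ n + C) {r : ℝ} (hr : r < 1 / 2) :
    ∃ A : ℝ, 0 ≤ A ∧ ∀ n : ℕ, r * ((n : ℝ) ^ 2 + 3 * n + 1) ≤ freeSum P n + A := by
  obtain ⟨M, hM⟩ := exists_nat_gt (2 / (1 / 2 - r))
  have hd : 0 < 1 / 2 - r := by linarith
  have hM0 : (0 : ℝ) < M := lt_trans (by positivity) hM
  obtain ⟨C, hC⟩ := hD M
  have hlow : ∀ n : ℕ, (n : ℝ) * (n - 1) / 2 ≤ freeSum P n + n * ((n + C) / M) := by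
    intro n
    have h1 : (∑ k ∈ Finset.range n, (k : ℝ)) = n * (n - 1) / 2 := by
      induction n with
      | zero => simp
      | succ n ih =>
        rw [Finset.sum_range_succ, ih]
        push_cast
        ring
    have h2 := Finset.sum_filter_add_sum_filter_not (Finset.range n) P (fun k => (k : ℝ))
    have h3 : ∑ k ∈ (Finset.range n).filter P, (k : ℝ) ≤
        ((Finset.range n).filter P).card • (n : ℝ) := by
      refine Finset.sum_le_card_nsmul _ _ _ fun k hk => ?_
      exact_mod_cast (Finset.mem_range.1 (Finset.mem_filter.1 hk).1).le
    have h4 : (((Finset.range n).filter P).card : ℝ) ≤ (n + C) / M := by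
      rw [le_div_iff₀ hM0, mul_comm]
      exact_mod_cast hC n
    have h5 : (freeSum P n : ℝ) = ∑ k ∈ Finset.range n with ¬ P k, (k : ℝ) := by
      simp [freeSum]
    rw [nsmul_eq_mul] at h3
    have h6 := mul_le_mul_of_nonneg_right h4 (Nat.cast_nonneg (α := ℝ) n)
    rw [← h1, ← h2, h5]
    linarith
  have hinv : 1 / (M : ℝ) ≤ (1 / 2 - r) / 2 := by
    rw [div_lt_iff₀ hd] at hM
    rw [div_le_div_iff₀ hM0 (by norm_num)]
    linarith
  set δ := (1 / 2 - r) / 2 with hδ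
  have hδ0 : 0 < δ := by positivity
  set b : ℝ := 1 / 2 + C * δ + 3 / 2 with hb
  refine ⟨b ^ 2 / (4 * δ) + 1 / 2, by positivity, fun n => ?_⟩
  have hn : (0 : ℝ) ≤ n := Nat.cast_nonneg n
  have h1 := hlow n
  have h2 : (n : ℝ) * ((n + C) / M) ≤ n * ((n + C) * δ) := by
    rw [div_eq_mul_one_div]
    gcongr
  have h3 : b * n ≤ δ * n ^ 2 + b ^ 2 / (4 * δ) := by
    have e : δ * n ^ 2 + b ^ 2 / (4 * δ) - b * n = (2 * δ * n - b) ^ 2 / (4 * δ) := by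
      field_simp
      ring
    have : 0 ≤ (2 * δ * n - b) ^ 2 / (4 * δ) := by positivity
    linarith
  have h4 : r = 1 / 2 - 2 * δ := by rw [hδ]; ring
  have h5 : r * (3 * n + 1) ≤ 1 / 2 * (3 * n + 1) := by gcongr
  have h6 : r * (n : ℝ) ^ 2 = n ^ 2 / 2 - 2 * δ * n ^ 2 := by rw [h4]; ring
  rw [hb] at h3 ⊢
  nlinarith

open Classical in
/-- The set of points whose digits are prescribed on a set of indices of density zero, and lie in
`[2 ^ k, 2 ^ (k + 1))` elsewhere, has dimension at least `1 / 2`. -/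
theorem half_le_dimH_of_prescribed (hc2 : ∀ k, 1 ≤ k → P k → 2 ≤ c k)
    (hc : ∀ k, P k → c k < 2 ^ (k + 1))
    (hD : ∀ M : ℕ, ∃ C : ℕ, ∀ n : ℕ, M * ((Finset.range n).filter P).card ≤ n + C) :
    1 / 2 ≤ dimH {x : ℝ | x ∈ Set.Ioo (0 : ℝ) 1 ∧ Irrational x ∧ ∀ k, 1 ≤ k →
      pq x k < 2 ^ (k + 1) ∧ (P k → pq x k = c k) ∧ (¬ P k → 2 ^ k ≤ pq x k)} := by
  have hex : ∀ y : ℝ, ∃ x, IsTails (fun k => digit P c y (k + 1)) x := by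
    intro y
    have h2 : ∀ k, 2 ≤ digit P c y (k + 1) := by
      intro k
      by_cases h : P (k + 1)
      · rw [digit_of_pos h]
        exact hc2 _ (by omega) h
      · refine le_trans ?_ (two_pow_le_digit h y)
        exact Nat.le_self_pow (by omega) 2
    obtain ⟨x, hx⟩ := exists_tails _ h2
    exact ⟨x, h2, hx.1, hx.2⟩
  choose X hX using hex
  refine le_of_forall_lt fun r hr => ?_
  have hrtop : r ≠ ⊤ := hr.ne_top
  lift r to ℝ≥0 using hrtop
  obtain ⟨s, hrs, hs⟩ := ENNReal.lt_iff_exists_nnreal_btwn.1 hr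
  refine lt_of_lt_of_le hrs ?_
  have hs0 : 0 < s := lt_of_le_of_lt (zero_le (a := r)) (by exact_mod_cast hrs)
  have hs2 : (s : ℝ) < 1 / 2 := by
    have : (s : ℝ≥0∞) < ((1 / 2 : ℝ≥0) : ℝ≥0∞) := by
      rwa [ENNReal.coe_div two_ne_zero, ENNReal.coe_one, ENNReal.coe_ofNat]
    have : s < 1 / 2 := by exact_mod_cast this
    exact_mod_cast this
  obtain ⟨A, hA0, hA⟩ := freeSum_lower hD hs2
  have hK : ∀ m, ∃ n, m ≤ freeSum P n := by
    intro m
    obtain ⟨A', -, hA'⟩ := freeSum_lower hD (show (1 / 3 : ℝ) < 1 / 2 by norm_num)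
    obtain ⟨n, hn⟩ := exists_nat_gt (A' + m)
    refine ⟨n, ?_⟩
    have h1 := hA' n
    have h2 : (0 : ℝ) ≤ (n : ℝ) ^ 2 := sq_nonneg _
    have : (m : ℝ) ≤ freeSum P n := by linarith
    exact_mod_cast this
  refine le_trans (le_dimH_image_of_inverse_holder (g := fun y => X y 0)
    (C := ⟨2 ^ A, by positivity⟩) hs0 ?_) (dimH_mono ?_)
  · intro y hy z hz
    rcases eq_or_ne y z with rfl | hyz
    · rw [sub_self, abs_zero]
      exact mul_nonneg (NNReal.coe_nonneg _) (Real.rpow_nonneg (abs_nonneg _) _)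
    have hne := exists_digit_ne (c := c) hy hz hyz hK
    have hN := Nat.find_spec hne
    have hmin : ∀ k < Nat.find hne, digit P c y k = digit P c z k :=
      fun k hk => not_not.1 (Nat.find_min hne hk)
    set N := Nat.find hne
    have hN0 : N ≠ 0 := by
      intro h0
      rw [h0] at hN
      by_cases h : P 0
      · simp [digit_of_pos h] at hN
      · simp [digit_of_neg h, Nat.mod_one] at hN
    obtain ⟨n, hn⟩ := Nat.exists_eq_succ_of_ne_zero hN0
    have hBd : ∀ w k, ((digit P c w (k + 1) : ℕ) : ℝ) + 1 ≤ 2 ^ (k + 2) := by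
      intro w k
      exact_mod_cast digit_lt hc w (k + 1)
    have hsep := (hX y).separation (hX z) (B := fun k => 2 ^ (k + 2)) (hBd y) (hBd z) n 0
      (fun i hi => hmin _ (by omega)) (by
        rw [zero_add, ← Nat.succ_eq_add_one, ← hn]
        exact hN)
    have hprod : ∀ m : ℕ, ∏ i ∈ Finset.range m, ((2 : ℝ) ^ (0 + i + 2)) ^ 2
        = 2 ^ (m ^ 2 + 3 * m) := by
      intro m
      induction m with
      | zero => simp
      | succ m ih =>
        rw [Finset.prod_range_succ, ih, ← pow_mul, ← pow_add]
        congr 1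
        ring
    rw [hprod, ← Nat.succ_eq_add_one, ← hn] at hsep
    have hyz1 := abs_sub_le_of_digit_eq hy hz N hmin
    have hx : (2 : ℝ) ^ (-((N : ℝ) ^ 2 + 3 * N + 1)) ≤ |X y 0 - X z 0| := by
      rw [Real.rpow_neg (by norm_num), inv_le_iff_one_le_mul₀ (by positivity)]
      refine hsep.trans_eq ?_
      rw [show ((N : ℝ) ^ 2 + 3 * N + 1) = ((N ^ 2 + 3 * N + 1 : ℕ) : ℝ) by push_cast; ring,
        Real.rpow_natCast, pow_succ]
      ring
    have hy2 : |y - z| ≤ (2 : ℝ) ^ (-(freeSum P N : ℝ)) := by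
      rw [Real.rpow_neg (by norm_num), Real.rpow_natCast, ← one_div,
        le_div_iff₀ (by positivity)]
      exact hyz1
    calc |y - z| ≤ (2 : ℝ) ^ (-(freeSum P N : ℝ)) := hy2
      _ ≤ 2 ^ (A + -((N : ℝ) ^ 2 + 3 * N + 1) * s) := by
        refine Real.rpow_le_rpow_of_exponent_le (by norm_num) ?_
        linarith [hA N]
      _ = 2 ^ A * (2 ^ (-((N : ℝ) ^ 2 + 3 * N + 1))) ^ (s : ℝ) := by
        rw [Real.rpow_add (by norm_num), Real.rpow_mul (by norm_num)]
      _ ≤ 2 ^ A * |X y 0 - X z 0| ^ (s : ℝ) := by gcongr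
      _ = _ := rfl
  · rintro _ ⟨y, -, rfl⟩
    refine ⟨⟨(hX y).pos 0, lt_of_le_of_lt ((hX y).le_half 0) (by norm_num)⟩,
      (hX y).irrational 0, fun k hk => ?_⟩
    obtain ⟨k, rfl⟩ := Nat.exists_eq_succ_of_ne_zero (by omega : k ≠ 0)
    rw [Nat.succ_eq_add_one, (hX y).pq_succ]
    exact ⟨digit_lt hc y _, fun h => digit_of_pos h y, fun h => two_pow_le_digit h y⟩

end Digits

section Blocks

variable {σ : ℕ → ℕ}

theorem le_of_gap (hσ1 : 1 ≤ σ 1) (hmono : ∀ n : ℕ, 1 ≤ n → σ n < σ (n + 1)) {n : ℕ}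
    (hn : 1 ≤ n) : n ≤ σ n := by
  induction n, hn using Nat.le_induction with
  | base => exact hσ1
  | succ n hn ih => have := hmono n hn; omega

theorem block_end_le (hmono : ∀ n : ℕ, 1 ≤ n → σ n < σ (n + 1))
    (hgap : ∀ n : ℕ, 1 ≤ n → n ≤ σ (n + 1) - σ n) {i j : ℕ} (hi : 1 ≤ i) (hij : i < j) :
    σ i + i ≤ σ j := by
  induction j, hij using Nat.le_induction with
  | base =>
    have := hmono i hi
    have := hgap i hi
    rw [Nat.succ_eq_add_one]
    omega
  | succ j hj ih => have := hmono j (by omega); omega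

open Classical in
theorem block_density (hσ1 : 1 ≤ σ 1) (hmono : ∀ n : ℕ, 1 ≤ n → σ n < σ (n + 1))
    (hlim : Filter.Tendsto (fun n : ℕ => ((σ (n + 1) - σ n : ℕ) : ℝ) / (n : ℝ))
      Filter.atTop Filter.atTop) (M : ℕ) :
    ∃ C : ℕ, ∀ n : ℕ,
      M * ((Finset.range n).filter fun k => ∃ j, 1 ≤ j ∧ σ j ≤ k ∧ k < σ j + j).card ≤ n + C := by
  obtain ⟨j₀, hj₀⟩ := Filter.eventually_atTop.1 (hlim.eventually_ge_atTop ((2 * M : ℕ) : ℝ))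
  have hstep : ∀ j, j₀ ≤ j → 1 ≤ j → 2 * M * j + σ j ≤ σ (j + 1) := by
    intro j hj hj1
    have h := hj₀ j hj
    rw [le_div_iff₀ (by exact_mod_cast hj1)] at h
    have h' : 2 * M * j ≤ σ (j + 1) - σ j := by exact_mod_cast h
    have := hmono j hj1
    omega
  have hsum : ∃ C : ℕ, ∀ m, 2 * M * ∑ i ∈ Finset.range m, i ≤ σ m + C := by
    refine ⟨2 * M * ∑ i ∈ Finset.range (j₀ + 1), i, fun m => ?_⟩
    rcases le_total m (j₀ + 1) with h | h
    · refine le_add_left (Nat.mul_le_mul_left _ ?_)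
      exact Finset.sum_le_sum_of_subset (Finset.range_mono h)
    · induction m, h using Nat.le_induction with
      | base => omega
      | succ m hm ih =>
        rw [Finset.sum_range_succ, mul_add]
        have := hstep m (by omega) (by omega)
        omega
  obtain ⟨C, hC⟩ := hsum
  refine ⟨C + 2 * M, fun n => ?_⟩
  set m := Nat.findGreatest (fun j => 1 ≤ j ∧ σ j < n) n with hm
  have hcard : ((Finset.range n).filter fun k => ∃ j, 1 ≤ j ∧ σ j ≤ k ∧ k < σ j + j).card
      ≤ ∑ i ∈ Finset.range (m + 1), i := by
    have hsub : ((Finset.range n).filter fun k => ∃ j, 1 ≤ j ∧ σ j ≤ k ∧ k < σ j + j) ⊆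
        (Finset.range (m + 1)).biUnion fun j => Finset.Ico (σ j) (σ j + j) := by
      intro k hk
      simp only [Finset.mem_filter, Finset.mem_range] at hk
      obtain ⟨hkn, j, hj, h1, h2⟩ := hk
      have hjσ := le_of_gap hσ1 hmono hj
      have hjm : j ≤ m := Nat.le_findGreatest (by omega) ⟨hj, by omega⟩
      simp only [Finset.mem_biUnion, Finset.mem_range, Finset.mem_Ico]
      exact ⟨j, by omega, h1, h2⟩
    refine (Finset.card_le_card hsub).trans (Finset.card_biUnion_le.trans ?_)
    exact Finset.sum_le_sum fun i _ => by simp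
  rcases Nat.eq_zero_or_pos m with h0 | hpos
  · rw [h0] at hcard
    have : ((Finset.range n).filter fun k => ∃ j, 1 ≤ j ∧ σ j ≤ k ∧ k < σ j + j).card = 0 := by
      simpa using hcard
    rw [this]
    omega
  · have hσm : σ m < n := (Nat.findGreatest_of_ne_zero hm.symm hpos.ne').2
    have hm2 : ∀ m : ℕ, m ≤ ∑ i ∈ Finset.range m, i + 2 := by
      intro m
      induction m with
      | zero => omega
      | succ m ih =>
        rw [Finset.sum_range_succ]
        rcases Nat.eq_zero_or_pos m with rfl | h <;> omega
    rw [Finset.sum_range_succ] at hcard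
    have h1 := hC m
    have h2 := hm2 m
    set S := ∑ i ∈ Finset.range m, i
    calc _ ≤ M * (S + m) := Nat.mul_le_mul_left _ hcard
      _ ≤ M * (2 * S + 2) := Nat.mul_le_mul_left _ (by omega)
      _ = 2 * M * S + 2 * M := by ring
      _ ≤ _ := by omega

end Blocks

/-- Proposition 4.2 (lower bound, case `β = ∞`): if `(σ_{n+1} - σ_n)/n → ∞` then
`dim_H G((σ_n)) ≥ 1/2`. -/
theorem stmt8 (σ : ℕ → ℕ) (hσ1 : 1 ≤ σ 1)
    (hmono : ∀ n : ℕ, 1 ≤ n → σ n < σ (n + 1))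
    (hgap : ∀ n : ℕ, 1 ≤ n → n ≤ σ (n + 1) - σ n)
    (hlim : Filter.Tendsto (fun n : ℕ => ((σ (n + 1) - σ n : ℕ) : ℝ) / (n : ℝ))
      Filter.atTop Filter.atTop) :
    1 / 2 ≤ dimH (Gset σ) := by
  classical
  set P : ℕ → Prop := fun k => ∃ j, 1 ≤ j ∧ σ j ≤ k ∧ k < σ j + j with hP
  have hstart : ∀ k, ∃ s, P k → ∃ j, 1 ≤ j ∧ s = σ j ∧ σ j ≤ k ∧ k < σ j + j := by
    intro k
    by_cases h : P k
    · obtain ⟨j, hj, h1, h2⟩ := h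
      exact ⟨σ j, fun _ => ⟨j, hj, rfl, h1, h2⟩⟩
    · exact ⟨0, fun h' => absurd h' h⟩
  choose s hs using hstart
  have hs_eq : ∀ j i, 1 ≤ j → i < j → s (σ j + i) = σ j := by
    intro j i hj hi
    obtain ⟨j', hj', he, h1, h2⟩ := hs (σ j + i) ⟨j, hj, by omega, by omega⟩
    rcases lt_trichotomy j j' with h | h | h
    · have := block_end_le hmono hgap hj h
      omega
    · rw [he, h]
    · have := block_end_le hmono hgap hj' h
      omega
  have hbound : ∀ k, P k → 2 ^ s k ≤ 2 ^ s k + (k - s k) ∧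
      2 ^ s k + (k - s k) < 2 ^ (s k + 1) ∧ 1 ≤ s k ∧ s k ≤ k := by
    intro k hk
    obtain ⟨j, hj, he, h1, h2⟩ := hs k hk
    have h3 := le_of_gap hσ1 hmono hj
    have h4 : s k < 2 ^ s k := Nat.lt_two_pow_self
    rw [pow_succ]
    omega
  refine (half_le_dimH_of_prescribed (P := P) (c := fun k => 2 ^ s k + (k - s k)) ?_ ?_
    (block_density hσ1 hmono hlim)).trans (dimH_mono ?_)
  · intro k _ hk
    obtain ⟨h1, -, h3, -⟩ := hbound k hk
    exact (Nat.le_self_pow (by omega) 2).trans h1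
  · intro k hk
    obtain ⟨-, h2, -, h4⟩ := hbound k hk
    exact h2.trans_le (Nat.pow_le_pow_right (by norm_num) (by omega))
  · rintro x ⟨hx, hirr, hdig⟩
    have hblock : ∀ j i, 1 ≤ j → i < j → pq x (σ j + i) = 2 ^ σ j + i := by
      intro j i hj hi
      have h3 := le_of_gap hσ1 hmono hj
      have h := (hdig (σ j + i) (by omega)).2.1 ⟨j, hj, by omega, by omega⟩
      rw [h, hs_eq j i hj hi, Nat.add_sub_cancel_left]
    refine ⟨⟨hx, hirr, fun k hk => ?_⟩, 1, fun j hj => ⟨1, fun i hi => ?_⟩⟩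
    · by_cases hPk : P (k + 1)
      · obtain ⟨j, hj, h1, h2⟩ := hPk
        obtain ⟨i, hi⟩ := Nat.exists_eq_add_of_le h1
        rw [hi, hblock j i hj (by omega)]
        rcases Nat.eq_zero_or_pos i with h0 | hpos
        · have := (hdig k hk).1
          rw [hi, h0, add_zero] at this
          omega
        · have hk' : k = σ j + (i - 1) := by omega
          rw [hk', hblock j (i - 1) hj (by omega)]
          omega
      · exact (hdig k hk).1.trans_le ((hdig (k + 1) (by omega)).2.2 hPk)
    · rw [add_assoc, hblock j (i + 1) hj (by omega), hblock j i hj (by omega)]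
      push_cast
      ring
end
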